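/- For every constant ε ∈ (0,1) there exist constants N = N(ε) > 0, γ₁ = γ₁(ε) > 0 and γ₂ = γ₂(ε) > 0 such that the following holds for all sufficiently large n and all Δ > N·log n. For every simple graph G on n vertices with maximum degree at most Δ, for all but at most a 2^{−γ₁·Δ} fraction of the injections σ : E(G) → {1,…,m} (where m = ⌊nΔ/2⌋), the randomized greedy algorithm 𝒜, playing the online edge coloring game Φ(n,Δ,ε) against the oblivious Builder strategy obl(G,σ), colors every edge of G with probability at least 1 − 2^{−γ₂·Δ}. -/

import Mathlib

open scoped Classical

namespace RandomGreedyEC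

/-- The state of the online edge-coloring game on vertex set `Fin n` with color
set `Fin K`: the list of presented edges (`none` = null edge), each together
with the color it was assigned (`none` = left uncolored). -/
abbrev State (n K : ℕ) := List (Option (Sym2 (Fin n)) × Option (Fin K))

/-- The set of colors that are free (not yet used on an incident edge) at every
endpoint of the edge `e` in the state `s`. -/
noncomputable def freeEdge (n K : ℕ) (s : State n K) (e : Sym2 (Fin n)) :
    Finset (Fin K) :=
  Finset.univ.filter fun c =>
    ∀ v ∈ e, ∀ p ∈ s, (∃ e', p.1 = some e' ∧ v ∈ e') → p.2 ≠ some c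

/-- One step of the randomized greedy algorithm `𝒜`: a non-null edge receives a
uniformly random legal color (and no color if there is none); a null edge
receives no color. -/
noncomputable def greedyStep (n K : ℕ) (s : State n K) :
    Option (Sym2 (Fin n)) → PMF (Option (Fin K))
  | none => PMF.pure none
  | some e =>
      if h : (freeEdge n K s e).Nonempty then (PMF.uniformOfFinset _ h).map some
      else PMF.pure none

/-- The distribution of the state of the game after a given number of steps,
when the randomized greedy algorithm plays against the Builder strategy `B`. -/
noncomputable def run (n K : ℕ) (B : State n K → Option (Sym2 (Fin n))) :
    ℕ → PMF (State n K)
  | 0 => PMF.pure []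
  | i + 1 =>
      (run n K B i).bind fun s =>
        (greedyStep n K s (B s)).map fun c => s ++ [(B s, c)]

/-- The oblivious Builder strategy `obl(G,σ)`: at step `i` (0-indexed, so at a
state of length `i`) it presents the edge of `G` that `σ` sends to position
`i`, and a null edge if there is no such edge. -/
noncomputable def obl (n K m : ℕ) (G : SimpleGraph (Fin n))
    (σ : G.edgeSet ↪ Fin m) : State n K → Option (Sym2 (Fin n)) := fun s =>
  if h : ∃ e : G.edgeSet, ((σ e : Fin m) : ℕ) = s.length then some h.choose.1
  else none

/-- Every edge of `G` has been presented and colored. -/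
def ColorsAll (n K : ℕ) (G : SimpleGraph (Fin n)) (s : State n K) : Prop :=
  ∀ e ∈ G.edgeSet, ∃ p ∈ s, p.1 = some e ∧ p.2 ≠ none

section Core

variable {n K : ℕ}

/-- The colors free at both endpoints of an edge, given the free colors at each vertex. -/
noncomputable def freeOf (F : Fin n → Finset (Fin K)) (e : Sym2 (Fin n)) : Finset (Fin K) :=
  Finset.univ.filter fun c => ∀ v ∈ e, c ∈ F v

/-- The neighbors of `u` along the edges of `R`. -/
noncomputable def nbr (R : Finset (Sym2 (Fin n))) (u : Fin n) : Finset (Fin n) :=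
  Finset.univ.filter fun w => s(u, w) ∈ R

/-- The neighbors of `u` along the edges of `R` at which the color `c` is free. -/
noncomputable def nbrFree (R : Finset (Sym2 (Fin n))) (F : Fin n → Finset (Fin K))
    (u : Fin n) (c : Fin K) : Finset (Fin n) :=
  (nbr R u).filter fun w => c ∈ F w

/-- The expectation of `J e c`, where each edge `e` of `R` is presented with probability `1 / ρ`
and `c` is a uniformly random color free for `e`. -/
noncomputable def avg (R : Finset (Sym2 (Fin n))) (F : Fin n → Finset (Fin K)) (ρ : ℝ)
    (J : Sym2 (Fin n) → Fin K → ℝ) : ℝ :=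
  (∑ e ∈ R, (∑ c ∈ freeOf F e, J e c) / ((freeOf F e).card : ℝ)) / ρ

/-- The total rate at which the color `c` is given to an edge of `R` satisfying `Q`. -/
noncomputable def edgeRate (R : Finset (Sym2 (Fin n))) (F : Fin n → Finset (Fin K))
    (Q : Sym2 (Fin n) → Prop) (c : Fin K) : ℝ :=
  ∑ e ∈ R, if Q e ∧ c ∈ freeOf F e then 1 / ((freeOf F e).card : ℝ) else 0

theorem freeOf_mk (F : Fin n → Finset (Fin K)) (u w : Fin n) :
    freeOf F s(u, w) = F u ∩ F w := by
  ext c; simp [freeOf]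

theorem avg_add (R : Finset (Sym2 (Fin n))) (F : Fin n → Finset (Fin K)) (ρ : ℝ)
    (J J' : Sym2 (Fin n) → Fin K → ℝ) :
    avg R F ρ (fun e c => J e c + J' e c) = avg R F ρ J + avg R F ρ J' := by
  simp only [avg, Finset.sum_add_distrib, add_div]

theorem avg_const_mul (R : Finset (Sym2 (Fin n))) (F : Fin n → Finset (Fin K)) (ρ a : ℝ)
    (J : Sym2 (Fin n) → Fin K → ℝ) :
    avg R F ρ (fun e c => a * J e c) = a * avg R F ρ J := by
  simp only [avg, ← Finset.mul_sum, mul_div_assoc]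

theorem avg_sum {ι : Type*} (S : Finset ι) (R : Finset (Sym2 (Fin n)))
    (F : Fin n → Finset (Fin K)) (ρ : ℝ) (J : ι → Sym2 (Fin n) → Fin K → ℝ) :
    avg R F ρ (fun e c => ∑ i ∈ S, J i e c) = ∑ i ∈ S, avg R F ρ (J i) := by
  induction S using Finset.induction_on with
  | empty => simp [avg]
  | insert a S ha ih => simp only [Finset.sum_insert ha, avg_add, ih]

theorem avg_mono {R : Finset (Sym2 (Fin n))} {F : Fin n → Finset (Fin K)} {ρ : ℝ} (hρ : 0 ≤ ρ)
    {J J' : Sym2 (Fin n) → Fin K → ℝ} (h : ∀ e ∈ R, ∀ c ∈ freeOf F e, J e c ≤ J' e c) :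
    avg R F ρ J ≤ avg R F ρ J' := by
  unfold avg
  gcongr with e he c hc
  exact h e he c hc

theorem avg_congr {R : Finset (Sym2 (Fin n))} {F : Fin n → Finset (Fin K)} {ρ : ℝ}
    {J J' : Sym2 (Fin n) → Fin K → ℝ} (h : ∀ e ∈ R, ∀ c ∈ freeOf F e, J e c = J' e c) :
    avg R F ρ J = avg R F ρ J' := by
  unfold avg
  congr 1
  refine Finset.sum_congr rfl fun e he => ?_
  rw [Finset.sum_congr rfl (h e he)]

theorem avg_color (R : Finset (Sym2 (Fin n))) (F : Fin n → Finset (Fin K)) (ρ : ℝ)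
    (Q : Sym2 (Fin n) → Prop) (c : Fin K) :
    avg R F ρ (fun e c' => if Q e ∧ c' = c then 1 else 0) = edgeRate R F Q c / ρ := by
  unfold avg edgeRate
  congr 1
  refine Finset.sum_congr rfl fun e _ => ?_
  by_cases hQ : Q e <;> simp [hQ, ite_div]

theorem avg_edge {R : Finset (Sym2 (Fin n))} {F : Fin n → Finset (Fin K)} (ρ : ℝ)
    {e₀ : Sym2 (Fin n)} (h₀ : e₀ ∈ R) (hF : (freeOf F e₀).Nonempty) :
    avg R F ρ (fun e _ => if e = e₀ then 1 else 0) = 1 / ρ := by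
  unfold avg
  congr 1
  have hc : ((freeOf F e₀).card : ℝ) ≠ 0 := by exact_mod_cast hF.card_pos.ne'
  rw [Finset.sum_eq_single e₀]
  · simp [hc]
  · intro e _ he; simp [he]
  · intro h; exact absurd h₀ h

theorem edgeRate_eq_mem (R : Finset (Sym2 (Fin n))) (F : Fin n → Finset (Fin K))
    {w : Fin n} {c : Fin K} (hc : c ∈ F w) :
    edgeRate R F (fun e => w ∈ e) c =
      ∑ x ∈ nbrFree R F w c, 1 / ((F w ∩ F x).card : ℝ) := by
  trans ∑ e ∈ R.filter fun e => w ∈ e ∧ c ∈ freeOf F e, 1 / ((freeOf F e).card : ℝ)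
  · rw [Finset.sum_filter]
    refine Finset.sum_congr rfl fun e _ => ?_
    congr
  symm
  refine Finset.sum_bij (fun x _ => s(w, x)) ?_ ?_ ?_ ?_
  · intro x hx
    simp only [nbrFree, nbr, Finset.mem_filter, Finset.mem_univ, true_and] at hx
    simp [hx.1, freeOf_mk, hc, hx.2]
  · intro x _ y _ h
    exact Sym2.congr_right.1 h
  · intro e he
    simp only [Finset.mem_filter] at he
    obtain ⟨heR, ⟨x, rfl⟩, hf⟩ := he
    rw [freeOf_mk, Finset.mem_inter] at hf
    exact ⟨x, by simp [nbrFree, nbr, heR, hf.2], rfl⟩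
  · intro x _
    rw [freeOf_mk]

theorem edgeRate_nonneg (R : Finset (Sym2 (Fin n))) (F : Fin n → Finset (Fin K))
    (Q : Sym2 (Fin n) → Prop) (c : Fin K) : 0 ≤ edgeRate R F Q c :=
  Finset.sum_nonneg fun e _ => by split_ifs <;> positivity

theorem edgeRate_single_le (R : Finset (Sym2 (Fin n))) (F : Fin n → Finset (Fin K))
    (e₀ : Sym2 (Fin n)) (c : Fin K) :
    edgeRate R F (fun e => e = e₀) c ≤ 1 / ((freeOf F e₀).card : ℝ) := by
  unfold edgeRate
  by_cases h₀ : e₀ ∈ R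
  · rw [Finset.sum_eq_single e₀]
    · split_ifs
      · exact le_rfl
      · positivity
    · intro e _ he; simp [he]
    · intro h; exact absurd h₀ h
  · rw [Finset.sum_eq_zero]
    · positivity
    · intro e he
      rw [if_neg]
      rintro ⟨rfl, -⟩
      exact h₀ he

/-- The potential of one tracked quantity does not increase in expectation. -/
theorem exp_avg_le {R : Finset (Sym2 (Fin n))} {F : Fin n → Finset (Fin K)} {ρ lam : ℝ}
    (hρ : 0 < ρ) (hlam : 0 ≤ lam) {J : Sym2 (Fin n) → Fin K → ℝ}
    (hJ : ∀ e ∈ R, ∀ c ∈ freeOf F e, |lam * J e c| ≤ 1) {y y' : ℝ}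
    (hy : y' + avg R F ρ J + lam * avg R F ρ (fun e c => J e c ^ 2) ≤ y) :
    Real.exp (lam * y') +
      avg R F ρ (fun e c => Real.exp (lam * (y' + J e c)) - Real.exp (lam * y')) ≤
      Real.exp (lam * y) := by
  have h1 : avg R F ρ (fun e c => Real.exp (lam * (y' + J e c)) - Real.exp (lam * y')) ≤
      Real.exp (lam * y') *
        (lam * avg R F ρ J + lam ^ 2 * avg R F ρ (fun e c => J e c ^ 2)) := by
    rw [← avg_const_mul, ← avg_const_mul, ← avg_add, ← avg_const_mul]
    refine avg_mono hρ.le fun e he c hc => ?_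
    rw [mul_add, Real.exp_add]
    have h2 := Real.abs_exp_sub_one_sub_id_le (hJ e he c hc)
    have h3 := (abs_le.1 h2).2
    have h4 := (Real.exp_pos (lam * y')).le
    have : Real.exp (lam * J e c) - 1 ≤ lam * J e c + lam ^ 2 * J e c ^ 2 := by
      rw [← mul_pow]; linarith
    nlinarith [mul_le_mul_of_nonneg_left this h4]
  set z := lam * avg R F ρ J + lam ^ 2 * avg R F ρ (fun e c => J e c ^ 2)
  calc _ ≤ Real.exp (lam * y') * (z + 1) := by linarith
    _ ≤ Real.exp (lam * y') * Real.exp z := by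
        gcongr; exact Real.add_one_le_exp z
    _ = Real.exp (lam * y' + z) := (Real.exp_add _ _).symm
    _ ≤ _ := by
        apply Real.exp_le_exp.2
        have := mul_le_mul_of_nonneg_left hy hlam
        simp only [z]; nlinarith

end Core

/-- The tracked quantities of the state `(R, F)` are within `err` of their ideal values, where
`p` is the fraction of the remaining time slots; `f` and `f'` are the ideal densities of the
free colors before and after the next step. -/
structure Tracked {n K : ℕ} (R : Finset (Sym2 (Fin n))) (F : Fin n → Finset (Fin K))
    (d f f' : Fin n → ℝ) (φ δ Δ m p err : ℝ) : Prop where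
  φ_pos : 0 < φ
  φ_le : φ ≤ 1
  δ_pos : 0 < δ
  δ_le : δ ≤ 1
  Δ_pos : 0 < Δ
  m_pos : 0 < m
  Δ_le_m : Δ ≤ m
  Δ_le_K : Δ ≤ K
  d_nonneg : ∀ u, 0 ≤ d u
  d_le : ∀ u, d u ≤ Δ
  le_f : ∀ u, φ ≤ f u
  f_le : ∀ u, f u ≤ 1
  le_f' : ∀ u, φ ≤ f' u
  f'_eq : ∀ u, f' u = f u - d u / (K * m)
  δ_le_p : δ ≤ p
  err_nonneg : 0 ≤ err
  err_le : err ≤ K * φ ^ 2 / 2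
  not_isDiag : ∀ e ∈ R, ¬ e.IsDiag
  card_nbr : ∀ u, ((nbr R u).card : ℝ) ≤ d u
  card_inter : ∀ u v, u ≠ v → |((F u ∩ F v).card : ℝ) - K * f u * f v| ≤ err
  sum_nbrFree : ∀ u c, |∑ w ∈ nbrFree R F u c, 1 / f w - p * d u| ≤ err

namespace Tracked

variable {n K : ℕ} {R : Finset (Sym2 (Fin n))} {F : Fin n → Finset (Fin K)}
  {d f f' : Fin n → ℝ} {φ δ Δ m p err : ℝ}

theorem K_pos (h : Tracked R F d f f' φ δ Δ m p err) : (0 : ℝ) < K :=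
  h.Δ_pos.trans_le h.Δ_le_K

theorem p_pos (h : Tracked R F d f f' φ δ Δ m p err) : 0 < p := h.δ_pos.trans_le h.δ_le_p

theorem f_pos (h : Tracked R F d f f' φ δ Δ m p err) (u : Fin n) : 0 < f u :=
  h.φ_pos.trans_le (h.le_f u)

theorem f'_pos (h : Tracked R F d f f' φ δ Δ m p err) (u : Fin n) : 0 < f' u :=
  h.φ_pos.trans_le (h.le_f' u)

theorem ne_of_mem_nbrFree (h : Tracked R F d f f' φ δ Δ m p err) {u w : Fin n} {c : Fin K}
    (hw : w ∈ nbrFree R F u c) : u ≠ w := by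
  simp only [nbrFree, nbr, Finset.mem_filter, Finset.mem_univ, true_and] at hw
  simpa using h.not_isDiag _ hw.1

theorem card_nbrFree_le (h : Tracked R F d f f' φ δ Δ m p err) (u : Fin n) (c : Fin K) :
    ((nbrFree R F u c).card : ℝ) ≤ d u :=
  le_trans (by exact_mod_cast Finset.card_filter_le _ _) (h.card_nbr u)

theorem le_card_inter (h : Tracked R F d f f' φ δ Δ m p err) {u v : Fin n} (huv : u ≠ v) :
    K * φ ^ 2 / 2 ≤ ((F u ∩ F v).card : ℝ) := by
  have h1 := (abs_le.1 (h.card_inter u v huv)).1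
  have h2 : (K : ℝ) * (φ * φ) ≤ K * (f u * f v) := by
    have := h.φ_pos.le
    have := h.f_pos u
    gcongr
    · exact h.le_f u
    · exact h.le_f v
  have := h.err_le
  nlinarith

theorem inter_nonempty (h : Tracked R F d f f' φ δ Δ m p err) {u v : Fin n} (huv : u ≠ v) :
    (F u ∩ F v).Nonempty := by
  have h1 := h.le_card_inter huv
  have h2 : 0 < (K : ℝ) * φ ^ 2 / 2 := by have := h.K_pos; have := h.φ_pos; positivity
  rw [← Finset.card_pos]
  exact_mod_cast h2.trans_le h1

theorem one_div_card_le (h : Tracked R F d f f' φ δ Δ m p err) {u v : Fin n} (huv : u ≠ v) :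
    1 / ((F u ∩ F v).card : ℝ) ≤ 2 / (K * φ ^ 2) := by
  have h2 : 0 < (K : ℝ) * φ ^ 2 / 2 := by have := h.K_pos; have := h.φ_pos; positivity
  calc 1 / ((F u ∩ F v).card : ℝ) ≤ 1 / (K * φ ^ 2 / 2) :=
        one_div_le_one_div_of_le h2 (h.le_card_inter huv)
    _ = _ := by rw [one_div_div]

theorem one_div_f'_le (h : Tracked R F d f f' φ δ Δ m p err) (u : Fin n) : 1 / f' u ≤ 1 / φ :=
  one_div_le_one_div_of_le h.φ_pos (h.le_f' u)

/-- The hit rate of a color at a vertex is bounded. -/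
theorem hitRate_le (h : Tracked R F d f f' φ δ Δ m p err) (u : Fin n) (c : Fin K) :
    ∑ w ∈ nbrFree R F u c, 1 / ((F u ∩ F w).card : ℝ) ≤ 2 * Δ / (K * φ ^ 2) := by
  have := h.K_pos
  have := h.φ_pos
  calc _ ≤ ∑ w ∈ nbrFree R F u c, 2 / (K * φ ^ 2) :=
        Finset.sum_le_sum fun w hw => h.one_div_card_le (h.ne_of_mem_nbrFree hw)
    _ = (nbrFree R F u c).card * (2 / (K * φ ^ 2)) := by simp
    _ ≤ Δ * (2 / (K * φ ^ 2)) := by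
        gcongr; exact (h.card_nbrFree_le u c).trans (h.d_le u)
    _ = _ := by ring

/-- The hit rate of a color at a vertex is close to its ideal value. -/
theorem abs_hitRate_sub_le (h : Tracked R F d f f' φ δ Δ m p err) (u : Fin n) (c : Fin K) :
    |∑ w ∈ nbrFree R F u c, 1 / ((F u ∩ F w).card : ℝ) - p * d u / (K * f u)| ≤
      3 * err / (K * φ ^ 4) := by
  have hK := h.K_pos
  have hφ := h.φ_pos
  have hfu := h.f_pos u
  have he := h.err_nonneg
  have hterm : ∀ w ∈ nbrFree R F u c,
      |1 / ((F u ∩ F w).card : ℝ) - 1 / (K * f u * f w)| ≤ 2 * err / (K ^ 2 * φ ^ 4) := by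
    intro w hw
    have huw := h.ne_of_mem_nbrFree hw
    have hA := h.le_card_inter huw
    have hd := h.card_inter u w huw
    have hfw := h.f_pos w
    set a : ℝ := ((F u ∩ F w).card : ℝ)
    have ha : 0 < a := lt_of_lt_of_le (by positivity) hA
    have hb : K * φ ^ 2 ≤ K * f u * f w := by
      rw [mul_assoc, pow_two]
      gcongr
      · exact h.le_f u
      · exact h.le_f w
    rw [div_sub_div _ _ ha.ne' (by positivity), abs_div, one_mul, mul_one, abs_sub_comm,
      abs_of_pos (show 0 < a * (K * f u * f w) by positivity)]
    calc _ ≤ err / ((K * φ ^ 2 / 2) * (K * φ ^ 2)) := by gcongr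
      _ = _ := by field_simp
  have hsum : |∑ w ∈ nbrFree R F u c, 1 / ((F u ∩ F w).card : ℝ) -
      ∑ w ∈ nbrFree R F u c, 1 / (K * f u * f w)| ≤ 2 * err / (K * φ ^ 4) := by
    rw [← Finset.sum_sub_distrib]
    calc _ ≤ ∑ w ∈ nbrFree R F u c, 2 * err / (K ^ 2 * φ ^ 4) :=
          (Finset.abs_sum_le_sum_abs _ _).trans (Finset.sum_le_sum hterm)
      _ = (nbrFree R F u c).card * (2 * err / (K ^ 2 * φ ^ 4)) := by simp
      _ ≤ K * (2 * err / (K ^ 2 * φ ^ 4)) := by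
          gcongr
          exact_mod_cast ((h.card_nbrFree_le u c).trans (h.d_le u)).trans h.Δ_le_K
      _ = _ := by field_simp
  have hmain : |∑ w ∈ nbrFree R F u c, 1 / (K * f u * f w) - p * d u / (K * f u)| ≤
      err / (K * φ ^ 4) := by
    have : ∑ w ∈ nbrFree R F u c, 1 / (K * f u * f w) - p * d u / (K * f u) =
        (∑ w ∈ nbrFree R F u c, 1 / f w - p * d u) / (K * f u) := by
      rw [sub_div, Finset.sum_div]
      congr 1
      refine Finset.sum_congr rfl fun w _ => ?_
      have := h.f_pos w
      field_simp
    rw [this, abs_div, abs_of_pos (show 0 < K * f u by positivity)]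
    have h4 : φ ^ 4 ≤ f u := (pow_le_of_le_one hφ.le h.φ_le (by norm_num)).trans (h.le_f u)
    gcongr
    exact h.sum_nbrFree u c
  calc _ ≤ _ := abs_sub_le _ _ _
    _ ≤ _ := add_le_add hsum hmain
    _ = _ := by ring

/-- The probability that a color is hit at a vertex is close to its ideal value. -/
theorem abs_hitProb_sub_le (h : Tracked R F d f f' φ δ Δ m p err) (u : Fin n) (c : Fin K) :
    |(∑ w ∈ nbrFree R F u c, 1 / ((F u ∩ F w).card : ℝ)) / (p * m) - d u / (K * m * f u)| ≤
      3 * err / (K * φ ^ 4) / (δ * m) := by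
  have hK := h.K_pos
  have hfu := h.f_pos u
  have hp := h.p_pos
  have hm := h.m_pos
  have hδ := h.δ_pos
  have hφ := h.φ_pos
  have he := h.err_nonneg
  have : d u / (K * m * f u) = p * d u / (K * f u) / (p * m) := by field_simp
  rw [this, ← sub_div, abs_div, abs_of_pos (show 0 < p * m by positivity)]
  gcongr
  · exact h.abs_hitRate_sub_le u c
  · exact h.δ_le_p

theorem one_div_le (h : Tracked R F d f f' φ δ Δ m p err) {x : ℝ} (hx : φ ^ 5 * δ ≤ x) :
    1 / (x * m) ≤ 1 / (φ ^ 5 * δ * m) := by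
  have := h.m_pos
  have := h.δ_pos
  have := h.φ_pos
  gcongr

theorem pow_five_mul_le (h : Tracked R F d f f' φ δ Δ m p err) {k : ℕ} (hk : k ≤ 5) :
    φ ^ 5 * δ ≤ φ ^ k * δ := by
  have := h.δ_pos
  have := h.φ_pos
  exact mul_le_mul_of_nonneg_right (pow_le_pow_of_le_one h.φ_pos.le h.φ_le hk) h.δ_pos.le

theorem pow_five_mul_le' (h : Tracked R F d f f' φ δ Δ m p err) {k : ℕ} (hk : k ≤ 5) :
    φ ^ 5 * δ ≤ φ ^ k := by
  have := h.φ_pos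
  refine (h.pow_five_mul_le hk).trans (mul_le_of_le_one_right (by positivity) h.δ_le)

/-- The change of `(F u ∩ F v).card` when the edge `e` gets the color `c'`. -/
noncomputable def jumpInter (F : Fin n → Finset (Fin K)) (u v : Fin n) (e : Sym2 (Fin n))
    (c' : Fin K) : ℝ :=
  -∑ c ∈ F u ∩ F v, if (u ∈ e ∨ v ∈ e) ∧ c' = c then 1 else 0

theorem jumpInter_eq (F : Fin n → Finset (Fin K)) (u v : Fin n) (e : Sym2 (Fin n))
    (c' : Fin K) :
    jumpInter F u v e c' = -if (u ∈ e ∨ v ∈ e) ∧ c' ∈ F u ∩ F v then 1 else 0 := by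
  unfold jumpInter
  by_cases h : u ∈ e ∨ v ∈ e <;> simp only [h, true_and, false_and, if_false]
  · simp
  · simp

theorem avg_jumpInter (h : Tracked R F d f f' φ δ Δ m p err) {u v : Fin n} (huv : u ≠ v) :
    ∃ τ : ℝ, 0 ≤ τ ∧ τ ≤ 1 ∧ avg R F (p * m) (jumpInter F u v) =
      τ / (p * m) - ∑ c ∈ F u ∩ F v,
        ((∑ w ∈ nbrFree R F u c, 1 / ((F u ∩ F w).card : ℝ)) / (p * m) +
          (∑ w ∈ nbrFree R F v c, 1 / ((F v ∩ F w).card : ℝ)) / (p * m)) := by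
  refine ⟨∑ c ∈ F u ∩ F v, edgeRate R F (fun e => e = s(u, v)) c,
    Finset.sum_nonneg fun c _ => edgeRate_nonneg _ _ _ _, ?_, ?_⟩
  · calc _ ≤ ∑ c ∈ F u ∩ F v, 1 / ((F u ∩ F v).card : ℝ) :=
          Finset.sum_le_sum fun c _ => by
            have := edgeRate_single_le R F s(u, v) c
            rwa [freeOf_mk] at this
      _ = 1 := by
          have : ((F u ∩ F v).card : ℝ) ≠ 0 := by
            exact_mod_cast (h.inter_nonempty huv).card_pos.ne'
          simp [this]
  · have h1 : avg R F (p * m) (jumpInter F u v) = -∑ c ∈ F u ∩ F v,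
        avg R F (p * m) (fun e c' => if (u ∈ e ∨ v ∈ e) ∧ c' = c then 1 else 0) := by
      rw [← avg_sum, ← neg_one_mul, ← avg_const_mul]
      simp only [neg_one_mul]
      rfl
    have h2 : ∀ c ∈ F u ∩ F v,
        avg R F (p * m) (fun e c' => if (u ∈ e ∨ v ∈ e) ∧ c' = c then 1 else 0) =
        (∑ w ∈ nbrFree R F u c, 1 / ((F u ∩ F w).card : ℝ)) / (p * m) +
          (∑ w ∈ nbrFree R F v c, 1 / ((F v ∩ F w).card : ℝ)) / (p * m) +
          (-1) * (edgeRate R F (fun e => e = s(u, v)) c / (p * m)) := by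
      intro c hc
      rw [Finset.mem_inter] at hc
      rw [← edgeRate_eq_mem R F hc.1, ← edgeRate_eq_mem R F hc.2, ← avg_color, ← avg_color,
        ← avg_color, ← avg_const_mul, ← avg_add, ← avg_add]
      refine avg_congr fun e _ c' _ => ?_
      have := Sym2.mem_and_mem_iff (z := e) huv
      by_cases hu : u ∈ e <;> by_cases hv : v ∈ e <;> by_cases hcc : c' = c <;>
        simp [hu, hv, hcc, ← this]
    rw [h1, Finset.sum_congr rfl h2, Finset.sum_add_distrib, Finset.sum_div, ← Finset.mul_sum]
    ring

theorem abs_drift_inter_le (h : Tracked R F d f f' φ δ Δ m p err) {u v : Fin n} (huv : u ≠ v) :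
    |K * f u * f v - K * f' u * f' v + avg R F (p * m) (jumpInter F u v)| ≤
      8 / (φ ^ 5 * δ) * (err + 1) / m := by
  have hK := h.K_pos
  have hfu := h.f_pos u
  have hfv := h.f_pos v
  have hp := h.p_pos
  have hm := h.m_pos
  have hδ := h.δ_pos
  have hφ := h.φ_pos
  have he := h.err_nonneg
  obtain ⟨τ, hτ0, hτ1, hτ⟩ := h.avg_jumpInter huv
  rw [hτ]
  have hA := h.card_inter u v huv
  have haK : ((F u ∩ F v).card : ℝ) ≤ K := by
    exact_mod_cast (Finset.card_le_univ _).trans_eq (Fintype.card_fin K)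
  set a : ℝ := ((F u ∩ F v).card : ℝ) with ha
  set S := ∑ c ∈ F u ∩ F v,
        ((∑ w ∈ nbrFree R F u c, 1 / ((F u ∩ F w).card : ℝ)) / (p * m) +
          (∑ w ∈ nbrFree R F v c, 1 / ((F v ∩ F w).card : ℝ)) / (p * m)) with hS
  have hS' : |S - a * (d u / (K * m * f u) + d v / (K * m * f v))| ≤
      6 * err / (φ ^ 4 * δ * m) := by
    have : a * (d u / (K * m * f u) + d v / (K * m * f v)) =
        ∑ c ∈ F u ∩ F v, (d u / (K * m * f u) + d v / (K * m * f v)) := by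
      rw [Finset.sum_const, nsmul_eq_mul]
    rw [this, hS, ← Finset.sum_sub_distrib]
    calc _ ≤ ∑ c ∈ F u ∩ F v, 2 * (3 * err / (K * φ ^ 4) / (δ * m)) := by
          refine (Finset.abs_sum_le_sum_abs _ _).trans (Finset.sum_le_sum fun c _ => ?_)
          rw [add_sub_add_comm, two_mul]
          exact (abs_add_le _ _).trans
            (add_le_add (h.abs_hitProb_sub_le u c) (h.abs_hitProb_sub_le v c))
      _ = a * (2 * (3 * err / (K * φ ^ 4) / (δ * m))) := by simp [ha]
      _ ≤ K * (2 * (3 * err / (K * φ ^ 4) / (δ * m))) := by gcongr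
      _ = _ := by field_simp; ring
  have hτ' : |τ / (p * m)| ≤ 1 / (δ * m) := by
    rw [abs_of_nonneg (by positivity)]
    gcongr
    exact h.δ_le_p
  have hdu := h.d_nonneg u
  have hdv := h.d_nonneg v
  have key : ∀ x : Fin n, |(a - K * f u * f v) * (d x / (K * m * f x))| ≤ err / (φ * m) := by
    intro x
    have hfx := h.f_pos x
    have hdx := h.d_nonneg x
    rw [abs_mul, abs_of_nonneg (show 0 ≤ d x / (K * m * f x) by positivity)]
    calc _ ≤ err * (K / (K * m * φ)) := by
          gcongr
          · exact (h.d_le x).trans h.Δ_le_K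
          · exact h.le_f x
      _ = _ := by field_simp
  have hsec : |d u * d v / (K * m ^ 2)| ≤ 1 / m := by
    rw [abs_of_nonneg (by positivity)]
    calc _ ≤ (K : ℝ) * m / (K * m ^ 2) := by
          gcongr
          · exact (h.d_le u).trans h.Δ_le_K
          · exact (h.d_le v).trans h.Δ_le_m
      _ = _ := by field_simp
  have hdecomp : K * f u * f v - K * f' u * f' v + (τ / (p * m) - S) =
      τ / (p * m) - (S - a * (d u / (K * m * f u) + d v / (K * m * f v))) -
      (a - K * f u * f v) * (d u / (K * m * f u)) -
      (a - K * f u * f v) * (d v / (K * m * f v)) - d u * d v / (K * m ^ 2) := by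
    rw [h.f'_eq u, h.f'_eq v]
    field_simp
    ring
  rw [hdecomp]
  have htri : ∀ a b c d e : ℝ, |a - b - c - d - e| ≤ |a| + |b| + |c| + |d| + |e| := by
    intro a b c d e
    have h1 := abs_sub (a - b - c - d) e
    have h2 := abs_sub (a - b - c) d
    have h3 := abs_sub (a - b) c
    have h4 := abs_sub a b
    linarith
  refine (htri _ _ _ _ _).trans ?_
  refine (add_le_add (add_le_add (add_le_add (add_le_add hτ' hS') (key u)) (key v)) hsec).trans ?_
  have i1 := h.one_div_le (by simpa using h.pow_five_mul_le (k := 0) (by norm_num))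
  have i2 := mul_le_mul_of_nonneg_left (h.one_div_le (h.pow_five_mul_le (k := 4) (by norm_num))) he
  have i3 := mul_le_mul_of_nonneg_left
    (h.one_div_le (by simpa using h.pow_five_mul_le' (k := 1) (by norm_num))) he
  have i4 := h.one_div_le (x := 1) (by simpa using h.pow_five_mul_le' (k := 0) (by norm_num))
  have e1 : 8 / (φ ^ 5 * δ) * (err + 1) / m =
    8 * (err * (1 / (φ ^ 5 * δ * m))) + 8 * (1 / (φ ^ 5 * δ * m)) := by field_simp
  have e2 : 6 * err / (φ ^ 4 * δ * m) = 6 * (err * (1 / (φ ^ 4 * δ * m))) := by ring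
  have e3 : err / (φ * m) = err * (1 / (φ * m)) := by ring
  have i5 : 0 < 1 / (φ ^ 5 * δ * m) := by positivity
  rw [e1, e2, e3]
  rw [one_mul] at i4
  linarith

theorem avg_sq_jumpInter_le (h : Tracked R F d f f' φ δ Δ m p err) {u v : Fin n} (huv : u ≠ v) :
    avg R F (p * m) (fun e c => jumpInter F u v e c ^ 2) ≤ 6 / (φ ^ 4 * δ) * Δ / m := by
  have hK := h.K_pos
  have hp := h.p_pos
  have hm := h.m_pos
  have hδ := h.δ_pos
  have hφ := h.φ_pos
  have hΔ := h.Δ_pos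
  obtain ⟨τ, hτ0, hτ1, hτ⟩ := h.avg_jumpInter huv
  have haK : ((F u ∩ F v).card : ℝ) ≤ K := by
    exact_mod_cast (Finset.card_le_univ _).trans_eq (Fintype.card_fin K)
  have h1 : avg R F (p * m) (fun e c => jumpInter F u v e c ^ 2) =
      -avg R F (p * m) (jumpInter F u v) := by
    rw [← neg_one_mul, ← avg_const_mul]
    refine avg_congr fun e _ c _ => ?_
    rw [jumpInter_eq]
    split_ifs <;> norm_num
  rw [h1, hτ, neg_sub]
  have hφ4 : φ ^ 4 ≤ φ ^ 2 := pow_le_pow_of_le_one hφ.le h.φ_le (by norm_num)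
  calc _ ≤ ∑ c ∈ F u ∩ F v, (2 * Δ / (K * φ ^ 2) / (p * m) + 2 * Δ / (K * φ ^ 2) / (p * m)) := by
        refine (sub_le_self _ (by positivity)).trans (Finset.sum_le_sum fun c _ => ?_)
        gcongr
        · exact h.hitRate_le u c
        · exact h.hitRate_le v c
    _ = ((F u ∩ F v).card : ℝ) * (4 * Δ / (K * φ ^ 2) / (p * m)) := by
        rw [Finset.sum_const, nsmul_eq_mul]; ring
    _ ≤ K * (4 * Δ / (K * φ ^ 2) / (p * m)) := by gcongr
    _ = 4 / (φ ^ 2 * p) * Δ / m := by field_simp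
    _ ≤ 6 / (φ ^ 4 * δ) * Δ / m := by
        gcongr
        · norm_num
        · exact h.δ_le_p

/-- The change of the weighted number of neighbors at which `c` is free when the edge `e` gets
the color `c'`. -/
noncomputable def jumpNbr (R : Finset (Sym2 (Fin n))) (F : Fin n → Finset (Fin K))
    (f' : Fin n → ℝ) (u : Fin n) (c : Fin K) (e : Sym2 (Fin n)) (c' : Fin K) : ℝ :=
  -∑ w ∈ nbrFree R F u c, 1 / f' w * if e = s(u, w) ∨ (w ∈ e ∧ c' = c) then 1 else 0

theorem abs_jumpNbr_le (h : Tracked R F d f f' φ δ Δ m p err) (u : Fin n) (c : Fin K)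
    (e : Sym2 (Fin n)) (c' : Fin K) : |jumpNbr R F f' u c e c'| ≤ 2 / φ := by
  have hφ := h.φ_pos
  have hnn : ∀ w, 0 ≤ 1 / f' w := fun w => by have := h.f'_pos w; positivity
  rw [jumpNbr, abs_neg, abs_of_nonneg (Finset.sum_nonneg fun w _ =>
    mul_nonneg (hnn w) (by split_ifs <;> norm_num))]
  calc _ ≤ ∑ w : Fin n, 1 / φ * if w ∈ e then 1 else 0 := by
        refine (Finset.sum_le_sum fun w _ => ?_).trans
          (Finset.sum_le_sum_of_subset_of_nonneg (Finset.subset_univ _) fun w _ _ => ?_)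
        · refine mul_le_mul (h.one_div_f'_le w) ?_ (by split_ifs <;> norm_num) (by positivity)
          by_cases hw : w ∈ e
          · rw [if_pos hw]; split_ifs <;> norm_num
          · rw [if_neg hw, if_neg]
            rintro (rfl | ⟨h1, -⟩)
            · exact hw (Sym2.mem_mk_right _ _)
            · exact hw h1
        · split_ifs <;> positivity
    _ = 1 / φ * ((Finset.univ.filter fun w => w ∈ e).card : ℝ) := by
        rw [← Finset.mul_sum, Finset.sum_boole]
    _ ≤ 1 / φ * 2 := by
        gcongr
        induction e with | _ x y =>
        have : (Finset.univ.filter fun w => w ∈ s(x, y)) ⊆ {x, y} := by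
          intro w; simp
        exact_mod_cast (Finset.card_le_card this).trans Finset.card_le_two
    _ = _ := by ring

theorem avg_jumpNbr (h : Tracked R F d f f' φ δ Δ m p err) (u : Fin n) (c : Fin K) :
    ∃ τ : Fin n → ℝ, (∀ w, 0 ≤ τ w) ∧ (∀ w ∈ nbrFree R F u c, τ w ≤ 2 / (K * φ ^ 2)) ∧
      avg R F (p * m) (jumpNbr R F f' u c) =
      -∑ w ∈ nbrFree R F u c, 1 / f' w * (1 / (p * m) +
        (∑ x ∈ nbrFree R F w c, 1 / ((F w ∩ F x).card : ℝ)) / (p * m) - τ w / (p * m)) := by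
  refine ⟨fun w => edgeRate R F (fun e => e = s(u, w)) c, fun w => edgeRate_nonneg _ _ _ _,
    fun w hw => ?_, ?_⟩
  · have := edgeRate_single_le R F s(u, w) c
    rw [freeOf_mk] at this
    exact this.trans (h.one_div_card_le (h.ne_of_mem_nbrFree hw))
  · have h1 : avg R F (p * m) (jumpNbr R F f' u c) = -∑ w ∈ nbrFree R F u c, 1 / f' w *
        avg R F (p * m) (fun e c' => if e = s(u, w) ∨ (w ∈ e ∧ c' = c) then 1 else 0) := by
      simp only [← avg_const_mul]
      rw [← avg_sum, ← neg_one_mul, ← avg_const_mul]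
      simp only [neg_one_mul]
      rfl
    rw [h1]
    congr 1
    refine Finset.sum_congr rfl fun w hw => ?_
    congr 1
    have hne := h.ne_of_mem_nbrFree hw
    simp only [nbrFree, nbr, Finset.mem_filter, Finset.mem_univ, true_and] at hw
    have hn : (freeOf F s(u, w)).Nonempty := by rw [freeOf_mk]; exact h.inter_nonempty hne
    have h2 : -(edgeRate R F (fun e => e = s(u, w)) c / (p * m)) =
        (-1) * (edgeRate R F (fun e => e = s(u, w)) c / (p * m)) := by ring
    rw [← edgeRate_eq_mem R F hw.2, ← avg_edge (p * m) hw.1 hn, sub_eq_add_neg, h2, ← avg_color,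
      ← avg_color, ← avg_const_mul, ← avg_add, ← avg_add]
    refine avg_congr fun e _ c' _ => ?_
    by_cases he : e = s(u, w)
    · subst he
      by_cases hcc : c' = c <;> simp [hcc]
    · simp [he]

theorem abs_drift_nbr_le (h : Tracked R F d f f' φ δ Δ m p err) (u : Fin n) (c : Fin K) :
    |∑ w ∈ nbrFree R F u c, 1 / f' w - ∑ w ∈ nbrFree R F u c, 1 / f w + d u / m +
      avg R F (p * m) (jumpNbr R F f' u c)| ≤ 8 / (φ ^ 5 * δ) * (err + 1) / m := by
  have hK := h.K_pos
  have hp := h.p_pos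
  have hm := h.m_pos
  have hδ := h.δ_pos
  have hφ := h.φ_pos
  have he := h.err_nonneg
  have hΔ := h.Δ_pos
  obtain ⟨τ, hτ0, hτ1, hτ⟩ := h.avg_jumpNbr u c
  rw [hτ]
  have hcard : ((nbrFree R F u c).card : ℝ) ≤ Δ := (h.card_nbrFree_le u c).trans (h.d_le u)
  have hdiff : ∀ w, 1 / f' w - 1 / f w = 1 / f' w * (d w / (K * m * f w)) := by
    intro w
    have h1 := h.f'_pos w
    have h2 := h.f_pos w
    have h3 := h.f'_eq w
    have h4 : f w - f' w = d w / (K * m) := by rw [h3]; ring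
    rw [div_sub_div _ _ h1.ne' h2.ne', one_mul, mul_one, h4]
    field_simp
  set X : Fin n → ℝ := fun w => (∑ x ∈ nbrFree R F w c, 1 / ((F w ∩ F x).card : ℝ)) / (p * m)
    with hX
  have hdecomp : ∑ w ∈ nbrFree R F u c, 1 / f' w - ∑ w ∈ nbrFree R F u c, 1 / f w + d u / m +
      -∑ w ∈ nbrFree R F u c, 1 / f' w * (1 / (p * m) + X w - τ w / (p * m)) =
      -∑ w ∈ nbrFree R F u c, 1 / f' w * (X w - d w / (K * m * f w)) +
      ∑ w ∈ nbrFree R F u c, 1 / f' w * (τ w / (p * m)) -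
      (∑ w ∈ nbrFree R F u c, 1 / f' w * (d w / (K * m * f w))) / (p * m) -
      (∑ w ∈ nbrFree R F u c, 1 / f w - p * d u) / (p * m) := by
    have h1 : (∑ w ∈ nbrFree R F u c, 1 / f' w * (d w / (K * m * f w))) =
        ∑ w ∈ nbrFree R F u c, 1 / f' w - ∑ w ∈ nbrFree R F u c, 1 / f w := by
      rw [← Finset.sum_sub_distrib]
      exact Finset.sum_congr rfl fun w _ => (hdiff w).symm
    simp only [mul_sub, mul_add, Finset.sum_sub_distrib, Finset.sum_add_distrib]
    rw [h1]
    rw [← Finset.sum_mul]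
    field_simp
    ring
  have hb1 : |∑ w ∈ nbrFree R F u c, 1 / f' w * (X w - d w / (K * m * f w))| ≤
      3 * err / (φ ^ 5 * δ * m) := by
    calc _ ≤ ∑ w ∈ nbrFree R F u c, 1 / φ * (3 * err / (K * φ ^ 4) / (δ * m)) := by
          refine (Finset.abs_sum_le_sum_abs _ _).trans (Finset.sum_le_sum fun w _ => ?_)
          have := h.f'_pos w
          rw [abs_mul, abs_of_pos (show 0 < 1 / f' w by positivity)]
          exact mul_le_mul (h.one_div_f'_le w) (h.abs_hitProb_sub_le w c) (abs_nonneg _)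
            (by positivity)
      _ = ((nbrFree R F u c).card : ℝ) * (1 / φ * (3 * err / (K * φ ^ 4) / (δ * m))) := by simp
      _ ≤ K * (1 / φ * (3 * err / (K * φ ^ 4) / (δ * m))) := by
          gcongr; exact_mod_cast hcard.trans h.Δ_le_K
      _ = _ := by field_simp
  have hb2 : |∑ w ∈ nbrFree R F u c, 1 / f' w * (τ w / (p * m))| ≤ 2 / (φ ^ 3 * δ * m) := by
    calc _ ≤ ∑ w ∈ nbrFree R F u c, 1 / φ * (2 / (K * φ ^ 2) / (δ * m)) := by
          refine (Finset.abs_sum_le_sum_abs _ _).trans (Finset.sum_le_sum fun w hw => ?_)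
          have h1 := h.f'_pos w
          have h2 := hτ0 w
          rw [abs_of_nonneg (by positivity)]
          gcongr
          · exact h.le_f' w
          · exact hτ1 w hw
          · exact h.δ_le_p
      _ = ((nbrFree R F u c).card : ℝ) * (1 / φ * (2 / (K * φ ^ 2) / (δ * m))) := by simp
      _ ≤ K * (1 / φ * (2 / (K * φ ^ 2) / (δ * m))) := by
          gcongr; exact_mod_cast hcard.trans h.Δ_le_K
      _ = _ := by field_simp
  have hb3 : |(∑ w ∈ nbrFree R F u c, 1 / f' w * (d w / (K * m * f w))) / (p * m)| ≤
      1 / (φ ^ 2 * δ * m) := by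
    rw [abs_div, abs_of_pos (show 0 < p * m by positivity)]
    calc _ ≤ (∑ w ∈ nbrFree R F u c, 1 / φ * (K / (K * m * φ))) / (δ * m) := by
          gcongr
          · refine (Finset.abs_sum_le_sum_abs _ _).trans (Finset.sum_le_sum fun w hw => ?_)
            have h1 := h.f'_pos w
            have h2 := h.f_pos w
            have h3 := h.d_nonneg w
            rw [abs_of_nonneg (by positivity)]
            gcongr
            · exact h.le_f' w
            · exact (h.d_le w).trans h.Δ_le_K
            · exact h.le_f w
          · exact h.δ_le_p
      _ = ((nbrFree R F u c).card : ℝ) * (1 / φ * (K / (K * m * φ))) / (δ * m) := by simp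
      _ ≤ m * (1 / φ * (K / (K * m * φ))) / (δ * m) := by
          gcongr; exact hcard.trans h.Δ_le_m
      _ = _ := by field_simp
  have hb4 : |(∑ w ∈ nbrFree R F u c, 1 / f w - p * d u) / (p * m)| ≤ err / (δ * m) := by
    rw [abs_div, abs_of_pos (show 0 < p * m by positivity)]
    gcongr
    · exact h.sum_nbrFree u c
    · exact h.δ_le_p
  rw [hdecomp]
  have htri : ∀ a b c d : ℝ, |-a + b - c - d| ≤ |a| + |b| + |c| + |d| := by
    intro a b c d
    have h1 := abs_sub (-a + b - c) d
    have h2 := abs_sub (-a + b) c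
    have h3 := abs_add_le (-a) b
    have h4 := abs_neg a
    linarith
  refine ((htri _ _ _ _).trans (add_le_add (add_le_add (add_le_add hb1 hb2) hb3) hb4)).trans ?_
  have i1 := h.one_div_le (h.pow_five_mul_le (k := 3) (by norm_num))
  have i2 := h.one_div_le (h.pow_five_mul_le (k := 2) (by norm_num))
  have i3 := mul_le_mul_of_nonneg_left
    (h.one_div_le (by simpa using h.pow_five_mul_le (k := 0) (by norm_num))) he
  have e1 : 8 / (φ ^ 5 * δ) * (err + 1) / m =
    8 * (err * (1 / (φ ^ 5 * δ * m))) + 8 * (1 / (φ ^ 5 * δ * m)) := by field_simp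
  have e2 : 3 * err / (φ ^ 5 * δ * m) = 3 * (err * (1 / (φ ^ 5 * δ * m))) := by ring
  have e3 : 2 / (φ ^ 3 * δ * m) = 2 * (1 / (φ ^ 3 * δ * m)) := by ring
  have e4 : err / (δ * m) = err * (1 / (δ * m)) := by ring
  have i5 : 0 < 1 / (φ ^ 5 * δ * m) := by positivity
  have i6 : 0 ≤ err * (1 / (φ ^ 5 * δ * m)) := by positivity
  rw [e1, e2, e3, e4]
  linarith

theorem avg_sq_jumpNbr_le (h : Tracked R F d f f' φ δ Δ m p err) (u : Fin n) (c : Fin K) :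
    avg R F (p * m) (fun e c' => jumpNbr R F f' u c e c' ^ 2) ≤ 6 / (φ ^ 4 * δ) * Δ / m := by
  have hK := h.K_pos
  have hp := h.p_pos
  have hm := h.m_pos
  have hδ := h.δ_pos
  have hφ := h.φ_pos
  have hΔ := h.Δ_pos
  obtain ⟨τ, hτ0, hτ1, hτ⟩ := h.avg_jumpNbr u c
  have hcard : ((nbrFree R F u c).card : ℝ) ≤ Δ := (h.card_nbrFree_le u c).trans (h.d_le u)
  have hnonpos : ∀ e c', jumpNbr R F f' u c e c' ≤ 0 := by
    intro e c'
    refine neg_nonpos.2 (Finset.sum_nonneg fun w _ => ?_)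
    have := h.f'_pos w
    split_ifs <;> positivity
  have h1 : avg R F (p * m) (fun e c' => jumpNbr R F f' u c e c' ^ 2) ≤
      -(2 / φ) * avg R F (p * m) (jumpNbr R F f' u c) := by
    rw [← avg_const_mul]
    refine avg_mono (by positivity) fun e _ c' _ => ?_
    have h2 := abs_le.1 (h.abs_jumpNbr_le u c e c')
    nlinarith [hnonpos e c', h2.1]
  refine h1.trans ?_
  rw [hτ, neg_mul_neg]
  have hφ2 : φ ^ 2 ≤ 1 := pow_le_one₀ hφ.le h.φ_le
  have hX : 2 * Δ / (K * φ ^ 2) ≤ 2 / φ ^ 2 := by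
    rw [div_le_div_iff₀ (by positivity) (by positivity)]
    have := h.Δ_le_K
    have : Δ * φ ^ 2 ≤ K * φ ^ 2 := by gcongr
    linarith
  have hone : 1 ≤ 1 / φ ^ 2 := by rw [le_div_iff₀ (by positivity)]; linarith
  calc _ ≤ 2 / φ * ∑ w ∈ nbrFree R F u c, 1 / φ * (3 / φ ^ 2 / (δ * m)) := by
        refine mul_le_mul_of_nonneg_left (Finset.sum_le_sum fun w hw => ?_) (by positivity)
        have h2 := h.f'_pos w
        refine (mul_le_mul_of_nonneg_left ?_ (by positivity)).trans
          (mul_le_mul_of_nonneg_right (h.one_div_f'_le w) (by positivity))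
        have h3 : 0 ≤ τ w / (p * m) := by have := hτ0 w; positivity
        rw [← add_div]
        refine (sub_le_self _ h3).trans ?_
        gcongr
        · calc _ ≤ 1 / φ ^ 2 + 2 / φ ^ 2 := add_le_add hone ((h.hitRate_le w c).trans hX)
            _ = _ := by ring
        · exact h.δ_le_p
    _ = 2 / φ * (((nbrFree R F u c).card : ℝ) * (1 / φ * (3 / φ ^ 2 / (δ * m)))) := by simp
    _ ≤ 2 / φ * (Δ * (1 / φ * (3 / φ ^ 2 / (δ * m)))) := by gcongr
    _ = _ := by field_simp; ring

end Tracked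

section Game

variable {n K : ℕ}

/-- The set of colors that are free at the vertex `v` in the state `s`. -/
noncomputable def freeAt (s : State n K) (v : Fin n) : Finset (Fin K) :=
  Finset.univ.filter fun c => ∀ p ∈ s, (∃ e', p.1 = some e' ∧ v ∈ e') → p.2 ≠ some c

/-- The edges of `G` not presented yet in the state `s`. -/
noncomputable def remaining (G : SimpleGraph (Fin n)) (s : State n K) : Finset (Sym2 (Fin n)) :=
  Finset.univ.filter fun e => e ∈ G.edgeSet ∧ ∀ p ∈ s, p.1 ≠ some e

/-- Every presented edge of the state `s` is colored. -/
def AllColored (s : State n K) : Prop := ∀ p ∈ s, p.1 ≠ none → p.2 ≠ none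

/-- The expectation of `h` after one step of the greedy algorithm on the presented edge. -/
noncomputable def stepExp (s : State n K) (h : State n K → ℝ) : Option (Sym2 (Fin n)) → ℝ
  | none => h (s ++ [(none, none)])
  | some e =>
      if (freeEdge n K s e).Nonempty then
        (∑ c ∈ freeEdge n K s e, h (s ++ [(some e, some c)])) / ((freeEdge n K s e).card : ℝ)
      else h (s ++ [(some e, none)])

/-- The probability that the greedy algorithm fails from the state `s` with `r` time slots left
when the remaining edges are presented in uniformly random slots. -/
noncomputable def failProb (G : SimpleGraph (Fin n)) : ℕ → State n K → ℝ
  | 0, s => if ColorsAll n K G s then 0 else 1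
  | r + 1, s => failProb G r (s ++ [(none, none)]) +
      (∑ e ∈ remaining G s,
        (stepExp s (failProb G r) (some e) - failProb G r (s ++ [(none, none)]))) / (r + 1 : ℝ)

theorem freeEdge_eq (s : State n K) (e : Sym2 (Fin n)) :
    freeEdge n K s e = freeOf (freeAt s) e := by
  ext c; simp [freeEdge, freeOf, freeAt]

theorem freeAt_append_none (s : State n K) (c : Option (Fin K)) :
    freeAt (s ++ [(none, c)]) = freeAt s := by
  ext v c'
  simp [freeAt, or_imp, forall_and]

theorem freeAt_append_some (s : State n K) (e : Sym2 (Fin n)) (c : Fin K) (v : Fin n) :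
    freeAt (s ++ [(some e, some c)]) v =
      if v ∈ e then (freeAt s v).erase c else freeAt s v := by
  ext c'
  by_cases hv : v ∈ e
  · simp only [freeAt, hv, if_true, Finset.mem_erase, Finset.mem_filter, Finset.mem_univ, true_and,
      List.mem_append, List.mem_singleton, or_imp, forall_and, forall_eq]
    constructor
    · rintro ⟨h1, h2⟩
      exact ⟨fun h => h2 ⟨e, rfl, hv⟩ (by rw [h]), h1⟩
    · rintro ⟨h1, h2⟩
      exact ⟨h2, fun _ h => h1 (Option.some.inj h).symm⟩
  · simp only [freeAt, hv, if_false, Finset.mem_filter, Finset.mem_univ, true_and,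
      List.mem_append, List.mem_singleton, or_imp, forall_and, forall_eq, and_iff_left_iff_imp]
    rintro - ⟨e', h1, h2⟩
    rw [← Option.some.inj h1] at h2
    exact absurd h2 hv

theorem remaining_append_none (G : SimpleGraph (Fin n)) (s : State n K) (c : Option (Fin K)) :
    remaining G (s ++ [(none, c)]) = remaining G s := by
  ext e
  simp [remaining, or_imp, forall_and]

theorem remaining_append_some (G : SimpleGraph (Fin n)) (s : State n K) (e : Sym2 (Fin n))
    (c : Option (Fin K)) :
    remaining G (s ++ [(some e, c)]) = (remaining G s).erase e := by
  ext e'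
  simp only [remaining, List.mem_append, List.mem_singleton, or_imp, forall_and, forall_eq,
    Finset.mem_filter, Finset.mem_univ, true_and, Finset.mem_erase, ne_eq, Option.some.injEq]
  constructor
  · rintro ⟨h1, h2, h3⟩
    exact ⟨fun h => h3 h.symm, h1, h2⟩
  · rintro ⟨h1, h2, h3⟩
    exact ⟨h2, h3, fun h => h1 h.symm⟩

theorem AllColored.append {s : State n K} (hs : AllColored s)
    {p : Option (Sym2 (Fin n)) × Option (Fin K)} (hp : p.1 ≠ none → p.2 ≠ none) :
    AllColored (s ++ [p]) := by
  intro q hq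
  rw [List.mem_append, List.mem_singleton] at hq
  rcases hq with hq | rfl
  · exact hs q hq
  · exact hp

theorem colorsAll_of_remaining_eq_empty {G : SimpleGraph (Fin n)} {s : State n K}
    (hs : AllColored s) (hR : remaining G s = ∅) : ColorsAll n K G s := by
  intro e he
  by_contra! hcon
  have : e ∈ remaining G s := by
    simp only [remaining, Finset.mem_filter, Finset.mem_univ, true_and]
    refine ⟨he, fun p hp h => ?_⟩
    exact hs p hp (by simp [h]) (hcon p hp h)
  simp [hR] at this

/-- Monotonicity of the one-step expectation. -/
theorem step_mono {R : Finset (Sym2 (Fin n))} {r : ℕ} (hR : R.card ≤ r + 1) {a a' : ℝ}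
    {S S' : Sym2 (Fin n) → ℝ} (ha : R.card ≤ r → a ≤ a') (hS : ∀ e ∈ R, S e ≤ S' e) :
    a + (∑ e ∈ R, (S e - a)) / (r + 1 : ℝ) ≤ a' + (∑ e ∈ R, (S' e - a')) / (r + 1 : ℝ) := by
  have hr : (0 : ℝ) < r + 1 := by positivity
  have h1 : ∀ (b : ℝ) (T : Sym2 (Fin n) → ℝ), b + (∑ e ∈ R, (T e - b)) / (r + 1 : ℝ) =
      ((r + 1 - R.card) * b + ∑ e ∈ R, T e) / (r + 1) := by
    intro b T
    rw [Finset.sum_sub_distrib, Finset.sum_const, nsmul_eq_mul]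
    field_simp
    ring
  rw [h1, h1]
  have h2 : ∑ e ∈ R, S e ≤ ∑ e ∈ R, S' e := Finset.sum_le_sum hS
  have h3 : ((r + 1 - R.card : ℝ)) * a ≤ (r + 1 - R.card) * a' := by
    rcases hR.lt_or_eq with h | h
    · have : (R.card : ℝ) ≤ r + 1 := by exact_mod_cast hR
      exact mul_le_mul_of_nonneg_left (ha (by omega)) (by linarith)
    · rw [h]; simp
  gcongr

theorem stepExp_le {s : State n K} {h : State n K → ℝ} {e : Sym2 (Fin n)} {b : ℝ}
    (h1 : ∀ c ∈ freeEdge n K s e, h (s ++ [(some e, some c)]) ≤ b)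
    (h2 : ¬ (freeEdge n K s e).Nonempty → h (s ++ [(some e, none)]) ≤ b) :
    stepExp s h (some e) ≤ b := by
  simp only [stepExp]
  split_ifs with hne
  · have : (0 : ℝ) < (freeEdge n K s e).card := by exact_mod_cast hne.card_pos
    rw [div_le_iff₀ this, mul_comm, ← nsmul_eq_mul]
    exact Finset.sum_le_card_nsmul _ _ _ h1
  · exact h2 hne

theorem card_remaining_append_le {G : SimpleGraph (Fin n)} {s : State n K} {r : ℕ}
    (hR : (remaining G s).card ≤ r + 1) {e : Sym2 (Fin n)} (he : e ∈ remaining G s)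
    (c : Option (Fin K)) : (remaining G (s ++ [(some e, c)])).card ≤ r := by
  rw [remaining_append_some, Finset.card_erase_of_mem he]
  omega

theorem failProb_le_one (G : SimpleGraph (Fin n)) (r : ℕ) (s : State n K)
    (hR : (remaining G s).card ≤ r) : failProb G r s ≤ 1 := by
  induction r generalizing s with
  | zero => unfold failProb; split_ifs <;> norm_num
  | succ r ih =>
    unfold failProb
    refine (step_mono (a' := 1) (S' := fun _ => 1) hR (fun h => ih _ ?_) fun e he => ?_).trans ?_
    · rwa [remaining_append_none]
    · exact stepExp_le (fun c _ => ih _ (card_remaining_append_le hR he _))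
        (fun _ => ih _ (card_remaining_append_le hR he _))
    · simp

/-- Every remaining edge has at least as many free colors as it has remaining incident edges. -/
def Safe (G : SimpleGraph (Fin n)) (s : State n K) : Prop :=
  ∀ u w, s(u, w) ∈ remaining G s → (nbr (remaining G s) u).card + (nbr (remaining G s) w).card ≤
    (freeAt s u ∩ freeAt s w).card

theorem Safe.freeEdge_nonempty {G : SimpleGraph (Fin n)} {s : State n K} (hs : Safe G s)
    {e : Sym2 (Fin n)} (he : e ∈ remaining G s) : (freeEdge n K s e).Nonempty := by
  induction e with | _ u w =>
  rw [freeEdge_eq, freeOf_mk, ← Finset.card_pos]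
  have h1 := hs u w he
  have h2 : 0 < (nbr (remaining G s) u).card :=
    Finset.card_pos.2 ⟨w, by simpa [nbr] using he⟩
  omega

theorem nbr_erase (R : Finset (Sym2 (Fin n))) (u x : Fin n) :
    nbr (R.erase s(u, x)) u = (nbr R u).erase x := by
  ext w
  simp only [nbr, Finset.mem_filter, Finset.mem_univ, true_and, Finset.mem_erase, ne_eq,
    Sym2.congr_right]

theorem card_nbr_erase_le (R : Finset (Sym2 (Fin n))) (e : Sym2 (Fin n)) (u : Fin n) :
    (nbr (R.erase e) u).card ≤ (nbr R u).card := by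
  refine Finset.card_le_card fun w => ?_
  simp only [nbr, Finset.mem_filter, Finset.mem_univ, true_and, Finset.mem_erase]
  exact fun h => h.2

theorem card_nbr_erase_of_mem {R : Finset (Sym2 (Fin n))} {e : Sym2 (Fin n)} (he : e ∈ R)
    {u : Fin n} (hu : u ∈ e) : (nbr (R.erase e) u).card + 1 = (nbr R u).card := by
  obtain ⟨x, rfl⟩ := hu
  rw [nbr_erase]
  exact Finset.card_erase_add_one (by simpa [nbr] using he)

theorem Safe.append {G : SimpleGraph (Fin n)} {s : State n K} (hs : Safe G s)
    {e : Sym2 (Fin n)} (he : e ∈ remaining G s) (c : Fin K) :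
    Safe G (s ++ [(some e, some c)]) := by
  intro u w huw
  rw [remaining_append_some] at huw ⊢
  rw [Finset.mem_erase] at huw
  have h1 := hs u w huw.2
  have hne : u ≠ w := by
    have := G.not_isDiag_of_mem_edgeSet (e := s(u, w)) (by
      have := huw.2
      simp only [remaining, Finset.mem_filter] at this
      exact this.2.1)
    simpa using this
  have hboth : ¬ (u ∈ e ∧ w ∈ e) := fun h => huw.1 ((Sym2.mem_and_mem_iff hne).1 h).symm
  have hu := card_nbr_erase_le (remaining G s) e u
  have hw := card_nbr_erase_le (remaining G s) e w
  rw [freeAt_append_some, freeAt_append_some]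
  by_cases h2 : u ∈ e
  · have h3 : w ∉ e := fun h => hboth ⟨h2, h⟩
    have := card_nbr_erase_of_mem he h2
    have h4 := Finset.pred_card_le_card_erase (s := freeAt s u ∩ freeAt s w) (a := c)
    rw [if_pos h2, if_neg h3, Finset.erase_inter]
    omega
  · by_cases h3 : w ∈ e
    · have := card_nbr_erase_of_mem he h3
      have h4 := Finset.pred_card_le_card_erase (s := freeAt s u ∩ freeAt s w) (a := c)
      rw [if_neg h2, if_pos h3, Finset.inter_erase]
      omega
    · rw [if_neg h2, if_neg h3]
      omega

theorem failProb_nonpos_of_safe {G : SimpleGraph (Fin n)} {r : ℕ} {s : State n K}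
    (hR : (remaining G s).card ≤ r) (hc : AllColored s) (hs : Safe G s) :
    failProb G r s ≤ 0 := by
  induction r generalizing s with
  | zero =>
    unfold failProb
    rw [if_pos (colorsAll_of_remaining_eq_empty hc (by simpa using hR))]
  | succ r ih =>
    unfold failProb
    refine (step_mono (a' := 0) (S' := fun _ => 0) hR (fun h => ih ?_ ?_ ?_)
      fun e he => ?_).trans ?_
    · rwa [remaining_append_none]
    · exact hc.append (by simp)
    · intro u w
      rw [remaining_append_none, freeAt_append_none]
      exact hs u w
    · exact stepExp_le (fun c _ => ih (card_remaining_append_le hR he _) (hc.append (by simp))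
        (hs.append he c)) (fun h => absurd (hs.freeEdge_nonempty he) h)
    · simp

end Game

section Potential

variable {n K : ℕ}

/-- The ideal density of the free colors at `u` with `r` of `m` time slots left. -/
noncomputable def density (K m : ℕ) (G : SimpleGraph (Fin n)) (r : ℕ) (u : Fin n) : ℝ :=
  1 - (1 - r / m) * ((G.neighborSet u).ncard : ℝ) / K

/-- The deviation of the number of colors free at both `u` and `v`. -/
noncomputable def devInter (m : ℕ) (G : SimpleGraph (Fin n)) (u v : Fin n) (r : ℕ)
    (s : State n K) : ℝ :=
  if u = v then 0 else
    ((freeAt s u ∩ freeAt s v).card : ℝ) - K * density K m G r u * density K m G r v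

/-- The deviation of the weighted number of remaining neighbors of `u` at which `c` is free. -/
noncomputable def devNbr (m : ℕ) (G : SimpleGraph (Fin n)) (u : Fin n) (c : Fin K) (r : ℕ)
    (s : State n K) : ℝ :=
  ∑ w ∈ nbrFree (remaining G s) (freeAt s) u c, 1 / density K m G r w -
    r / m * ((G.neighborSet u).ncard : ℝ)

/-- The allowed deviation with `r` of `m` time slots left. -/
noncomputable def envelope (m : ℕ) (Δ C η : ℝ) (r : ℕ) : ℝ :=
  η * Δ * Real.exp (C * (1 - r / m))

/-- The potential of a single deviation `y` with allowance `b`. -/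
noncomputable def pot (lam b y : ℝ) : ℝ :=
  Real.exp (lam * (y - b)) + Real.exp (lam * (-y - b))

/-- The total potential of a state. -/
noncomputable def potential (m : ℕ) (G : SimpleGraph (Fin n)) (Δ C η : ℝ) (r : ℕ)
    (s : State n K) : ℝ :=
  ∑ u, ∑ v, pot η (envelope m Δ C η r) (devInter m G u v r s) +
    ∑ u, ∑ c, pot η (envelope m Δ C η r) (devNbr m G u c r s)

theorem pot_pos (lam b y : ℝ) : 0 < pot lam b y := by unfold pot; positivity

theorem abs_le_of_pot_lt_one {lam b y : ℝ} (hlam : 0 < lam) (h : pot lam b y < 1) :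
    |y| ≤ b := by
  unfold pot at h
  have h1 := Real.exp_pos (lam * (y - b))
  have h2 := Real.exp_pos (lam * (-y - b))
  have h3 : lam * (y - b) < 0 := by rw [← Real.exp_lt_one_iff]; linarith
  have h4 : lam * (-y - b) < 0 := by rw [← Real.exp_lt_one_iff]; linarith
  have h5 := neg_of_mul_neg_right h3 hlam.le
  have h6 := neg_of_mul_neg_right h4 hlam.le
  exact abs_le.2 ⟨by linarith, by linarith⟩

theorem pot_zero (lam b : ℝ) : pot lam b 0 = 2 * Real.exp (-(lam * b)) := by
  unfold pot; ring_nf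

/-- The potential of one deviation does not increase in expectation. -/
theorem pot_avg_le {R : Finset (Sym2 (Fin n))} {F : Fin n → Finset (Fin K)} {ρ lam : ℝ}
    (hρ : 0 < ρ) (hlam : 0 ≤ lam) {J : Sym2 (Fin n) → Fin K → ℝ}
    (hJ : ∀ e ∈ R, ∀ c ∈ freeOf F e, |lam * J e c| ≤ 1) {y y' b b' : ℝ}
    (hy : |y' - y + avg R F ρ J| + lam * avg R F ρ (fun e c => J e c ^ 2) ≤ b' - b) :
    pot lam b' y' + avg R F ρ (fun e c => pot lam b' (y' + J e c) - pot lam b' y') ≤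
      pot lam b y := by
  have habs := abs_le.1 (le_refl |y' - y + avg R F ρ J|)
  have h1 := exp_avg_le hρ hlam hJ (y' := y' - b') (y := y - b) (by linarith)
  have hneg : avg R F ρ (fun e c => -J e c) = -avg R F ρ J := by
    rw [← neg_one_mul, ← avg_const_mul]; simp
  have h2 := exp_avg_le hρ hlam (J := fun e c => -J e c) (by simpa using hJ)
    (y' := -y' - b') (y := -y - b) (by rw [hneg]; simp only [neg_sq]; linarith)
  have h3 : avg R F ρ (fun e c => pot lam b' (y' + J e c) - pot lam b' y') =
      avg R F ρ (fun e c => Real.exp (lam * (y' - b' + J e c)) - Real.exp (lam * (y' - b'))) +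
      avg R F ρ (fun e c => Real.exp (lam * (-y' - b' + -J e c)) -
        Real.exp (lam * (-y' - b'))) := by
    rw [← avg_add]
    refine avg_congr fun e _ c _ => ?_
    unfold pot
    rw [show y' + J e c - b' = y' - b' + J e c by ring,
      show -(y' + J e c) - b' = -y' - b' + -J e c by ring]
    ring
  rw [h3]
  unfold pot
  linarith

theorem density_append (m : ℕ) (G : SimpleGraph (Fin n)) (r : ℕ) (u : Fin n) (hm : 0 < m) :
    density K m G r u = density K m G (r + 1) u -
      ((G.neighborSet u).ncard : ℝ) / ((K : ℝ) * (m : ℝ)) := by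
  have : (m : ℝ) ≠ 0 := by exact_mod_cast hm.ne'
  unfold density
  push_cast
  field_simp
  ring

theorem mem_nbrFree {R : Finset (Sym2 (Fin n))} {F : Fin n → Finset (Fin K)} {u w : Fin n}
    {c : Fin K} : w ∈ nbrFree R F u c ↔ s(u, w) ∈ R ∧ c ∈ F w := by
  simp [nbrFree, nbr]

theorem devInter_append (m : ℕ) (G : SimpleGraph (Fin n)) {u v : Fin n} (huv : u ≠ v) (r : ℕ)
    (s : State n K) (e : Sym2 (Fin n)) (c : Fin K) :
    devInter m G u v r (s ++ [(some e, some c)]) =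
      devInter m G u v r (s ++ [(none, none)]) + Tracked.jumpInter (freeAt s) u v e c := by
  have key : ((freeAt (s ++ [(some e, some c)]) u ∩ freeAt (s ++ [(some e, some c)]) v).card : ℝ) =
      ((freeAt s u ∩ freeAt s v).card : ℝ) + Tracked.jumpInter (freeAt s) u v e c := by
    rw [Tracked.jumpInter_eq, freeAt_append_some, freeAt_append_some]
    have h1 : (if u ∈ e then (freeAt s u).erase c else freeAt s u) ∩
        (if v ∈ e then (freeAt s v).erase c else freeAt s v) =
        if u ∈ e ∨ v ∈ e then (freeAt s u ∩ freeAt s v).erase c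
          else freeAt s u ∩ freeAt s v := by
      ext c'
      by_cases hu : u ∈ e <;> by_cases hv : v ∈ e <;> simp [hu, hv] <;> tauto
    rw [h1]
    by_cases h : u ∈ e ∨ v ∈ e
    · by_cases hc : c ∈ freeAt s u ∩ freeAt s v
      · rw [if_pos h, if_pos ⟨h, hc⟩, ← Finset.card_erase_add_one hc]
        push_cast
        ring
      · rw [if_pos h, if_neg (fun h => hc h.2), Finset.erase_eq_of_notMem hc]
        ring
    · rw [if_neg h, if_neg (fun h' => h h'.1)]
      ring
  rw [devInter, devInter, if_neg huv, if_neg huv, key, freeAt_append_none]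
  ring

theorem devNbr_append (m : ℕ) (G : SimpleGraph (Fin n)) (u : Fin n) (c : Fin K) (r : ℕ)
    (s : State n K) (e : Sym2 (Fin n)) (c' : Fin K) :
    devNbr m G u c r (s ++ [(some e, some c')]) =
      devNbr m G u c r (s ++ [(none, none)]) +
        Tracked.jumpNbr (remaining G s) (freeAt s) (density K m G r) u c e c' := by
  have h1 : nbrFree (remaining G (s ++ [(some e, some c')])) (freeAt (s ++ [(some e, some c')]))
      u c = (nbrFree (remaining G s) (freeAt s) u c).filter
        fun w => ¬ (e = s(u, w) ∨ (w ∈ e ∧ c' = c)) := by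
    ext w
    rw [Finset.mem_filter, mem_nbrFree, mem_nbrFree, remaining_append_some, freeAt_append_some,
      Finset.mem_erase]
    by_cases hw : w ∈ e
    · rw [if_pos hw, Finset.mem_erase]
      simp only [ne_eq, hw, true_and, not_or, eq_comm (a := e), eq_comm (a := c')]
      tauto
    · rw [if_neg hw]
      simp only [ne_eq, hw, false_and, or_false, eq_comm (a := e)]
      tauto
  unfold devNbr Tracked.jumpNbr
  rw [h1, remaining_append_none, freeAt_append_none, Finset.sum_filter]
  have h2 : ∑ w ∈ nbrFree (remaining G s) (freeAt s) u c,
      (if ¬ (e = s(u, w) ∨ (w ∈ e ∧ c' = c)) then 1 / density K m G r w else 0) =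
      ∑ w ∈ nbrFree (remaining G s) (freeAt s) u c, 1 / density K m G r w -
      ∑ w ∈ nbrFree (remaining G s) (freeAt s) u c, 1 / density K m G r w *
        if e = s(u, w) ∨ (w ∈ e ∧ c' = c) then 1 else 0 := by
    rw [← Finset.sum_sub_distrib]
    refine Finset.sum_congr rfl fun w _ => ?_
    by_cases h : e = s(u, w) ∨ (w ∈ e ∧ c' = c)
    · rw [if_neg (not_not.2 h), if_pos h]; ring
    · rw [if_pos h, if_neg h]; ring
  rw [h2]
  ring

/-- The relations between the parameters of the game and of the potential. -/
structure Admissible (K m : ℕ) (G : SimpleGraph (Fin n)) (φ δ Δ C η : ℝ) : Prop where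
  φ_pos : 0 < φ
  φ_le : φ ≤ 1
  δ_pos : 0 < δ
  δ_le : δ ≤ φ ^ 4 / 32
  Δ_pos : 0 < Δ
  Δ_le_m : Δ ≤ m
  φ_le_sub : φ ≤ 1 - Δ / K
  deg_le : ∀ u, ((G.neighborSet u).ncard : ℝ) ≤ Δ
  Δ_le_K : Δ ≤ K
  C_eq : C = 24 / (φ ^ 5 * δ)
  η_pos : 0 < η
  η_exp_le : η * Real.exp C ≤ φ ^ 4 / 16
  one_le_η : 1 ≤ η * Δ
  one_le_δ : 1 ≤ δ * m

namespace Admissible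

variable {m : ℕ} {G : SimpleGraph (Fin n)} {φ δ Δ C η : ℝ}

theorem m_pos (h : Admissible K m G φ δ Δ C η) : (0 : ℝ) < m := h.Δ_pos.trans_le h.Δ_le_m

theorem K_pos (h : Admissible K m G φ δ Δ C η) : (0 : ℝ) < K := h.Δ_pos.trans_le h.Δ_le_K

theorem C_pos (h : Admissible K m G φ δ Δ C η) : 0 < C := by
  have := h.φ_pos; have := h.δ_pos
  rw [h.C_eq]; positivity

theorem φ_pow_le_one (h : Admissible K m G φ δ Δ C η) (k : ℕ) : φ ^ k ≤ 1 :=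
  pow_le_one₀ h.φ_pos.le h.φ_le

theorem le_density (h : Admissible K m G φ δ Δ C η) {r : ℕ} (u : Fin n) :
    φ ≤ density K m G r u := by
  have hK := h.K_pos
  have h2 : (1 - r / m) * ((G.neighborSet u).ncard : ℝ) ≤ Δ := by
    have h3 : (1 - (r : ℝ) / m) ≤ 1 := by
      have : (0 : ℝ) ≤ r / m := by positivity
      linarith
    calc _ ≤ 1 * ((G.neighborSet u).ncard : ℝ) := by gcongr
      _ ≤ Δ := by rw [one_mul]; exact h.deg_le u
  have h4 : (1 - r / m) * ((G.neighborSet u).ncard : ℝ) / K ≤ Δ / K := by gcongr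
  have := h.φ_le_sub
  unfold density
  linarith

theorem density_le (h : Admissible K m G φ δ Δ C η) {r : ℕ} (hr : r ≤ m) (u : Fin n) :
    density K m G r u ≤ 1 := by
  have hm := h.m_pos
  have h1 : (r : ℝ) / m ≤ 1 := by rw [div_le_one hm]; exact_mod_cast hr
  have h2 : 0 ≤ (1 - r / m) * ((G.neighborSet u).ncard : ℝ) / K := by
    have : 0 ≤ 1 - (r : ℝ) / m := by linarith
    positivity
  unfold density
  linarith

theorem le_envelope (h : Admissible K m G φ δ Δ C η) {r : ℕ} (hr : r ≤ m) :
    η * Δ ≤ envelope m Δ C η r := by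
  have hm := h.m_pos
  have h1 : (r : ℝ) / m ≤ 1 := by rw [div_le_one hm]; exact_mod_cast hr
  have h2 := h.one_le_η
  unfold envelope
  refine le_mul_of_one_le_right (by linarith) (Real.one_le_exp ?_)
  exact mul_nonneg h.C_pos.le (by linarith)

theorem envelope_le (h : Admissible K m G φ δ Δ C η) (r : ℕ) :
    envelope m Δ C η r ≤ φ ^ 4 / 16 * Δ := by
  have h1 := h.one_le_η
  have h3 := h.Δ_pos
  calc envelope m Δ C η r ≤ η * Δ * Real.exp C := by
        unfold envelope
        gcongr
        refine mul_le_of_le_one_right h.C_pos.le ?_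
        have : (0 : ℝ) ≤ r / m := by positivity
        linarith
    _ = η * Real.exp C * Δ := by ring
    _ ≤ _ := by gcongr; exact h.η_exp_le

theorem budget (h : Admissible K m G φ δ Δ C η) {r : ℕ} (hr : r + 1 ≤ m) :
    8 / (φ ^ 5 * δ) * (envelope m Δ C η (r + 1) + 1) / m + η * (6 / (φ ^ 4 * δ) * Δ / m) ≤
      envelope m Δ C η r - envelope m Δ C η (r + 1) := by
  have hm := h.m_pos
  have hφ := h.φ_pos
  have hδ := h.δ_pos
  have hη := h.η_pos
  have hΔ := h.Δ_pos
  have h1 := h.le_envelope hr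
  have h2 := h.one_le_η
  have h3 : envelope m Δ C η r = envelope m Δ C η (r + 1) * Real.exp (C / m) := by
    unfold envelope
    rw [mul_assoc (η * Δ), ← Real.exp_add]
    congr 2
    push_cast
    field_simp
    ring
  set E := envelope m Δ C η (r + 1)
  have hE : 0 < E := by linarith
  have h4 : C / m + 1 ≤ Real.exp (C / m) := Real.add_one_le_exp _
  have h5 : E * (C / m) ≤ envelope m Δ C η r - E := by
    rw [h3]
    nlinarith [mul_le_mul_of_nonneg_left h4 hE.le]
  refine le_trans ?_ h5
  rw [h.C_eq]
  have h6 : 6 / (φ ^ 4 * δ) ≤ 8 / (φ ^ 5 * δ) := by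
    have h7 : φ ^ 5 ≤ φ ^ 4 := pow_le_pow_of_le_one hφ.le h.φ_le (by norm_num)
    exact div_le_div₀ (by norm_num) (by norm_num) (by positivity)
      (mul_le_mul_of_nonneg_right h7 hδ.le)
  have hQ : 0 < 8 / (φ ^ 5 * δ) := by positivity
  calc _ ≤ 8 / (φ ^ 5 * δ) * (E + E) / m + η * (8 / (φ ^ 5 * δ) * Δ / m) := by
        gcongr; linarith
    _ = 8 / (φ ^ 5 * δ) * (E + E + η * Δ) / m := by ring
    _ ≤ 8 / (φ ^ 5 * δ) * (E + E + E) / m := by gcongr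
    _ = _ := by ring

theorem card_nbr_remaining_le (G : SimpleGraph (Fin n)) (s : State n K) (u : Fin n) :
    (nbr (remaining G s) u).card ≤ (G.neighborSet u).ncard := by
  rw [← Set.ncard_coe_finset]
  refine Set.ncard_le_ncard (fun w hw => ?_) (Set.toFinite _)
  simp only [nbr, remaining, Finset.coe_filter, Finset.mem_filter, Finset.mem_univ, true_and,
    Set.mem_ofPred_eq, SimpleGraph.mem_edgeSet] at hw
  exact hw.1

theorem tracked (h : Admissible K m G φ δ Δ C η) {r : ℕ} (hr : r + 1 ≤ m)
    (hδr : δ * m ≤ (r + 1 : ℕ)) {s : State n K} (hs : potential m G Δ C η (r + 1) s < 1) :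
    Tracked (remaining G s) (freeAt s) (fun u => ((G.neighborSet u).ncard : ℝ))
      (density K m G (r + 1)) (density K m G r) φ δ Δ m ((r + 1 : ℕ) / m)
      (envelope m Δ C η (r + 1)) := by
  have hΔ := h.Δ_pos
  have hφ := h.φ_pos
  have hpos : ∀ y, 0 ≤ pot η (envelope m Δ C η (r + 1)) y := fun y => (pot_pos _ _ _).le
  have hsum1 : 0 ≤ ∑ u, ∑ v, pot η (envelope m Δ C η (r + 1)) (devInter m G u v (r + 1) s) :=
    Finset.sum_nonneg fun u _ => Finset.sum_nonneg fun v _ => hpos _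
  have hsum2 : 0 ≤ ∑ u, ∑ c, pot η (envelope m Δ C η (r + 1)) (devNbr m G u c (r + 1) s) :=
    Finset.sum_nonneg fun u _ => Finset.sum_nonneg fun v _ => hpos _
  unfold potential at hs
  refine
    { φ_pos := hφ
      φ_le := h.φ_le
      δ_pos := h.δ_pos
      δ_le := h.δ_le.trans (by have := h.φ_pow_le_one 4; linarith)
      Δ_pos := hΔ
      m_pos := h.m_pos
      Δ_le_m := h.Δ_le_m
      Δ_le_K := h.Δ_le_K
      d_nonneg := fun u => Nat.cast_nonneg _
      d_le := h.deg_le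
      le_f := h.le_density
      f_le := h.density_le hr
      le_f' := h.le_density
      f'_eq := fun u => density_append m G r u (by exact_mod_cast h.m_pos)
      δ_le_p := (le_div_iff₀ h.m_pos).2 hδr
      err_nonneg := by have := h.le_envelope hr; have := h.one_le_η; linarith
      err_le := ?_
      not_isDiag := ?_
      card_nbr := fun u => by exact_mod_cast card_nbr_remaining_le G s u
      card_inter := ?_
      sum_nbrFree := ?_ }
  · refine (h.envelope_le _).trans ?_
    have h4 : φ ^ 4 ≤ φ ^ 2 := pow_le_pow_of_le_one hφ.le h.φ_le (by norm_num)
    have h5 := mul_le_mul h.Δ_le_K h4 (by positivity) (by positivity)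
    have h6 : 0 ≤ Δ * φ ^ 4 := by positivity
    linarith
  · intro e he
    simp only [remaining, Finset.mem_filter] at he
    exact G.not_isDiag_of_mem_edgeSet he.2.1
  · intro u v huv
    have h1 := Finset.single_le_sum (f := fun u => ∑ v, pot η (envelope m Δ C η (r + 1))
      (devInter m G u v (r + 1) s)) (fun u _ => Finset.sum_nonneg fun v _ => hpos _)
      (Finset.mem_univ u)
    have h2 := Finset.single_le_sum (f := fun v => pot η (envelope m Δ C η (r + 1))
      (devInter m G u v (r + 1) s)) (fun v _ => hpos _) (Finset.mem_univ v)
    have h3 := abs_le_of_pot_lt_one h.η_pos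
      (show pot η (envelope m Δ C η (r + 1)) (devInter m G u v (r + 1) s) < 1 by linarith)
    rwa [devInter, if_neg huv] at h3
  · intro u c
    have h1 := Finset.single_le_sum (f := fun u => ∑ c, pot η (envelope m Δ C η (r + 1))
      (devNbr m G u c (r + 1) s)) (fun u _ => Finset.sum_nonneg fun v _ => hpos _)
      (Finset.mem_univ u)
    have h2 := Finset.single_le_sum (f := fun c => pot η (envelope m Δ C η (r + 1))
      (devNbr m G u c (r + 1) s)) (fun v _ => hpos _) (Finset.mem_univ c)
    exact abs_le_of_pot_lt_one h.η_pos
      (show pot η (envelope m Δ C η (r + 1)) (devNbr m G u c (r + 1) s) < 1 by linarith)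

theorem η_mul_le (h : Admissible K m G φ δ Δ C η) : η * (2 / φ) ≤ 1 := by
  have hφ := h.φ_pos
  have h1 : η ≤ φ ^ 4 / 16 :=
    (le_mul_of_one_le_right h.η_pos.le (Real.one_le_exp h.C_pos.le)).trans h.η_exp_le
  have h2 : φ ^ 4 ≤ φ := pow_le_of_le_one hφ.le h.φ_le (by norm_num)
  rw [← mul_div_assoc, div_le_one hφ]
  linarith

/-- From a state of potential less than one, the potential does not increase in expectation. -/
theorem potential_step_le (h : Admissible K m G φ δ Δ C η) {r : ℕ} (hr : r + 1 ≤ m)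
    (hδr : δ * m ≤ (r + 1 : ℕ)) {s : State n K} (hs : potential m G Δ C η (r + 1) s < 1) :
    potential m G Δ C η r (s ++ [(none, none)]) +
      avg (remaining G s) (freeAt s) (r + 1 : ℝ) (fun e c =>
        potential m G Δ C η r (s ++ [(some e, some c)]) -
          potential m G Δ C η r (s ++ [(none, none)])) ≤ potential m G Δ C η (r + 1) s := by
  have ht := h.tracked hr hδr hs
  have hb := h.budget hr
  have hm := h.m_pos
  have hη := h.η_pos
  have hφ := h.φ_pos
  have hρ : ((r + 1 : ℕ) : ℝ) / m * m = (r + 1 : ℝ) := by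
    rw [div_mul_cancel₀ _ hm.ne']; push_cast; ring
  have hr0 : (0 : ℝ) < r + 1 := by positivity
  set b' := envelope m Δ C η r
  set b := envelope m Δ C η (r + 1)
  have hbb : b ≤ b' := by
    have hδ := h.δ_pos
    have := ht.err_nonneg
    have := h.Δ_pos
    have : 0 ≤ b' - b := le_trans (by positivity) hb
    linarith
  have hone : ∀ x : ℝ, |x| ≤ 2 / φ → |η * x| ≤ 1 := by
    intro x hx
    rw [abs_mul, abs_of_pos hη]
    exact (mul_le_mul_of_nonneg_left hx hη.le).trans h.η_mul_le
  have hA : ∀ u v, pot η b' (devInter m G u v r (s ++ [(none, none)])) +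
      avg (remaining G s) (freeAt s) (r + 1 : ℝ) (fun e c =>
        pot η b' (devInter m G u v r (s ++ [(some e, some c)])) -
          pot η b' (devInter m G u v r (s ++ [(none, none)]))) ≤
      pot η b (devInter m G u v (r + 1) s) := by
    intro u v
    by_cases huv : u = v
    · have h0 : ∀ (r : ℕ) (s : State n K), devInter m G u v r s = 0 := fun r s => by
        rw [devInter, if_pos huv]
      have hz : avg (remaining G s) (freeAt s) (r + 1 : ℝ)
          (fun _ _ => pot η b' 0 - pot η b' 0) = 0 := by simp [avg]
      simp only [h0]
      rw [hz, add_zero, pot_zero, pot_zero]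
      gcongr
    · simp only [devInter_append m G huv]
      refine pot_avg_le hr0 hη.le (fun e _ c _ => hone _ ?_) ?_
      · rw [Tracked.jumpInter_eq, abs_neg]
        have : 1 ≤ 2 / φ := by rw [le_div_iff₀ hφ]; linarith [h.φ_le]
        split_ifs
        · simpa using this
        · simp; positivity
      · have h1 := ht.abs_drift_inter_le huv
        have h2 := mul_le_mul_of_nonneg_left (ht.avg_sq_jumpInter_le huv) hη.le
        rw [hρ] at h1 h2
        refine le_trans (add_le_add ?_ h2) hb
        have hk : devInter m G u v r (s ++ [(none, none)]) - devInter m G u v (r + 1) s =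
            K * density K m G (r + 1) u * density K m G (r + 1) v -
              K * density K m G r u * density K m G r v := by
          simp only [devInter, if_neg huv, freeAt_append_none]
          ring
        rwa [hk]
  have hB : ∀ u c₀, pot η b' (devNbr m G u c₀ r (s ++ [(none, none)])) +
      avg (remaining G s) (freeAt s) (r + 1 : ℝ) (fun e c =>
        pot η b' (devNbr m G u c₀ r (s ++ [(some e, some c)])) -
          pot η b' (devNbr m G u c₀ r (s ++ [(none, none)]))) ≤
      pot η b (devNbr m G u c₀ (r + 1) s) := by
    intro u c₀
    simp only [devNbr_append m G]
    refine pot_avg_le hr0 hη.le (fun e _ c _ => hone _ (ht.abs_jumpNbr_le u c₀ e c)) ?_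
    have h1 := ht.abs_drift_nbr_le u c₀
    have h2 := mul_le_mul_of_nonneg_left (ht.avg_sq_jumpNbr_le u c₀) hη.le
    rw [hρ] at h1 h2
    refine le_trans (add_le_add ?_ h2) hb
    have hk : devNbr m G u c₀ r (s ++ [(none, none)]) - devNbr m G u c₀ (r + 1) s =
        ∑ w ∈ nbrFree (remaining G s) (freeAt s) u c₀, 1 / density K m G r w -
          ∑ w ∈ nbrFree (remaining G s) (freeAt s) u c₀, 1 / density K m G (r + 1) w +
          ((G.neighborSet u).ncard : ℝ) / m := by
      simp only [devNbr, freeAt_append_none, remaining_append_none]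
      push_cast
      ring
    rwa [hk]
  have hsplit : avg (remaining G s) (freeAt s) (r + 1 : ℝ) (fun e c =>
        potential m G Δ C η r (s ++ [(some e, some c)]) -
          potential m G Δ C η r (s ++ [(none, none)])) =
      ∑ u, ∑ v, avg (remaining G s) (freeAt s) (r + 1 : ℝ) (fun e c =>
        pot η b' (devInter m G u v r (s ++ [(some e, some c)])) -
          pot η b' (devInter m G u v r (s ++ [(none, none)]))) +
      ∑ u, ∑ c₀, avg (remaining G s) (freeAt s) (r + 1 : ℝ) (fun e c =>
        pot η b' (devNbr m G u c₀ r (s ++ [(some e, some c)])) -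
          pot η b' (devNbr m G u c₀ r (s ++ [(none, none)]))) := by
    simp only [← avg_sum]
    rw [← avg_add]
    refine avg_congr fun e _ c _ => ?_
    simp only [potential, Finset.sum_sub_distrib]
    ring
  rw [hsplit]
  have hA' := Finset.sum_le_sum fun u (_ : u ∈ Finset.univ) =>
    Finset.sum_le_sum fun v (_ : v ∈ Finset.univ) => hA u v
  have hB' := Finset.sum_le_sum fun u (_ : u ∈ Finset.univ) =>
    Finset.sum_le_sum fun c (_ : c ∈ Finset.univ) => hB u c
  simp only [Finset.sum_add_distrib] at hA' hB'
  simp only [potential]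
  linarith

end Admissible

end Potential

section Bound

variable {n K : ℕ}

theorem Tracked.card_nbr_mul_le {R : Finset (Sym2 (Fin n))} {F : Fin n → Finset (Fin K)}
    {d f f' : Fin n → ℝ} {φ δ Δ m p err : ℝ} (h : Tracked R F d f f' φ δ Δ m p err)
    (u : Fin n) : ((nbr R u).card : ℝ) * φ ^ 2 ≤ 2 * (p * Δ + err) := by
  have hK := h.K_pos
  have h1 : ∑ c, ∑ w ∈ nbrFree R F u c, 1 / f w ≤ K * (p * Δ + err) := by
    calc _ ≤ ∑ _c : Fin K, (p * Δ + err) := by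
          refine Finset.sum_le_sum fun c _ => ?_
          have h2 := (abs_le.1 (h.sum_nbrFree u c)).2
          have h3 := mul_le_mul_of_nonneg_left (h.d_le u) h.p_pos.le
          linarith
      _ = _ := by rw [Finset.sum_const, Finset.card_univ, Fintype.card_fin, nsmul_eq_mul]
  have h2 : ∑ c, ∑ w ∈ nbrFree R F u c, 1 / f w =
      ∑ w ∈ nbr R u, ((F w).card : ℝ) * (1 / f w) := by
    simp only [nbrFree, Finset.sum_filter]
    rw [Finset.sum_comm]
    refine Finset.sum_congr rfl fun w _ => ?_
    rw [← Finset.sum_filter, Finset.sum_const, nsmul_eq_mul, Finset.filter_univ_mem]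
  have h3 : ∑ _w ∈ nbr R u, (K * φ ^ 2 / 2 : ℝ) ≤
      ∑ w ∈ nbr R u, ((F w).card : ℝ) * (1 / f w) := by
    refine Finset.sum_le_sum fun w hw => ?_
    have huw : u ≠ w := by
      simp only [nbr, Finset.mem_filter, Finset.mem_univ, true_and] at hw
      simpa using h.not_isDiag _ hw
    have h4 : ((F u ∩ F w).card : ℝ) ≤ (F w).card := by
      exact_mod_cast Finset.card_le_card Finset.inter_subset_right
    have h5 : 1 ≤ 1 / f w := by rw [le_div_iff₀ (h.f_pos w)]; linarith [h.f_le w]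
    exact ((h.le_card_inter huw).trans h4).trans
      (le_mul_of_one_le_right (Nat.cast_nonneg _) h5)
  rw [Finset.sum_const, nsmul_eq_mul] at h3
  rw [h2] at h1
  refine le_of_mul_le_mul_left ?_ hK
  linarith

namespace Admissible

variable {m : ℕ} {G : SimpleGraph (Fin n)} {φ δ Δ C η : ℝ}

theorem safe (h : Admissible K m G φ δ Δ C η) {r : ℕ} (hr : r + 1 ≤ m)
    (hδr : δ * m ≤ (r + 1 : ℕ)) (hrδ : ((r + 1 : ℕ) : ℝ) ≤ 2 * (δ * m)) {s : State n K}
    (hs : potential m G Δ C η (r + 1) s < 1) : Safe G s := by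
  have ht := h.tracked hr hδr hs
  have hφ := h.φ_pos
  have hΔ := h.Δ_pos
  have hp : ((r + 1 : ℕ) : ℝ) / m ≤ φ ^ 4 / 16 := by
    rw [div_le_iff₀ h.m_pos]
    have := mul_le_mul_of_nonneg_right h.δ_le h.m_pos.le
    linarith
  have herr := h.envelope_le (r + 1)
  have hdeg : ∀ u, ((nbr (remaining G s) u).card : ℝ) ≤ Δ * φ ^ 2 / 4 := by
    intro u
    have h1 := ht.card_nbr_mul_le u
    have h2 := mul_le_mul_of_nonneg_right hp hΔ.le
    refine le_of_mul_le_mul_right ?_ (pow_pos hφ 2)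
    calc _ ≤ _ := h1
      _ ≤ 2 * (φ ^ 4 / 16 * Δ + φ ^ 4 / 16 * Δ) := by linarith
      _ = _ := by ring
  intro u w huw
  have hne : u ≠ w := by simpa using ht.not_isDiag _ huw
  have h1 := ht.le_card_inter hne
  have h2 := mul_le_mul_of_nonneg_right h.Δ_le_K (sq_nonneg φ)
  have h3 : (((nbr (remaining G s) u).card + (nbr (remaining G s) w).card : ℕ) : ℝ) ≤
      ((freeAt s u ∩ freeAt s w).card : ℝ) := by
    push_cast
    linarith [hdeg u, hdeg w]
  exact_mod_cast h3

theorem potential_nonneg (m : ℕ) (G : SimpleGraph (Fin n)) (Δ C η : ℝ) (r : ℕ)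
    (s : State n K) : 0 ≤ potential m G Δ C η r s :=
  add_nonneg (Finset.sum_nonneg fun _ _ => Finset.sum_nonneg fun _ _ => (pot_pos _ _ _).le)
    (Finset.sum_nonneg fun _ _ => Finset.sum_nonneg fun _ _ => (pot_pos _ _ _).le)

theorem stop_pos (h : Admissible K m G φ δ Δ C η) : 0 < ⌈δ * m⌉₊ :=
  Nat.ceil_pos.2 (by linarith [h.one_le_δ])

theorem stop_le (h : Admissible K m G φ δ Δ C η) : ⌈δ * m⌉₊ ≤ m := by
  refine Nat.ceil_le.2 (mul_le_of_le_one_left h.m_pos.le ?_)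
  have := h.φ_pow_le_one 4
  linarith [h.δ_le]

/-- The failure probability is bounded by the potential. -/
theorem failProb_le_potential (h : Admissible K m G φ δ Δ C η) {r : ℕ} (hr : ⌈δ * m⌉₊ ≤ r)
    (hrm : r ≤ m) {s : State n K} (hR : (remaining G s).card ≤ r) (hc : AllColored s) :
    failProb G r s ≤ potential m G Δ C η r s := by
  induction r, hr using Nat.le_induction generalizing s with
  | base =>
    rcases lt_or_ge (potential m G Δ C η ⌈δ * m⌉₊ s) 1 with h1 | h1
    · refine (failProb_nonpos_of_safe hR hc ?_).trans (potential_nonneg _ _ _ _ _ _ _)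
      have h2 := h.stop_pos
      have h3 := Nat.le_ceil (δ * m)
      have h4 := Nat.ceil_lt_add_one (a := δ * m) (by linarith [h.one_le_δ])
      have h5 := h.one_le_δ
      obtain ⟨k, hk⟩ := Nat.exists_eq_succ_of_ne_zero h2.ne'
      rw [Nat.succ_eq_add_one] at hk
      rw [hk] at h1 h3 h4 hrm
      exact h.safe hrm h3 (by linarith) h1
    · exact (failProb_le_one G _ s hR).trans h1
  | succ r hr ih =>
    rcases lt_or_ge (potential m G Δ C η (r + 1) s) 1 with h1 | h1
    · have hδr : δ * m ≤ (r + 1 : ℕ) := by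
        have : (⌈δ * m⌉₊ : ℝ) ≤ r := by exact_mod_cast hr
        have := Nat.le_ceil (δ * m)
        push_cast
        linarith
      have ht := h.tracked hrm hδr h1
      have hne : ∀ e ∈ remaining G s, (freeEdge n K s e).Nonempty := by
        intro e he
        have hd := ht.not_isDiag e he
        induction e with | _ u w =>
        rw [freeEdge_eq, freeOf_mk]
        exact ht.inter_nonempty (by simpa using hd)
      unfold failProb
      refine (step_mono (a' := potential m G Δ C η r (s ++ [(none, none)]))
        (S' := fun e => stepExp s (potential m G Δ C η r) (some e)) hR (fun h' => ?_)
        fun e he => ?_).trans (le_trans (le_of_eq ?_) (h.potential_step_le hrm hδr h1))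
      · exact ih (by omega) (by rwa [remaining_append_none]) (hc.append (by simp))
      · simp only [stepExp, if_pos (hne e he)]
        gcongr with c hc'
        exact ih (by omega) (card_remaining_append_le hR he _) (hc.append (by simp))
      · unfold avg
        congr 2
        refine Finset.sum_congr rfl fun e he => ?_
        have hpos : ((freeEdge n K s e).card : ℝ) ≠ 0 := by
          exact_mod_cast (hne e he).card_pos.ne'
        simp only [stepExp, if_pos (hne e he)]
        rw [← freeEdge_eq, Finset.sum_sub_distrib, Finset.sum_const, nsmul_eq_mul, sub_div,
          mul_div_cancel_left₀ _ hpos]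
    · exact (failProb_le_one G _ s hR).trans h1

theorem freeAt_nil (u : Fin n) : freeAt ([] : State n K) u = Finset.univ := by
  simp [freeAt]

theorem devInter_nil (h : Admissible K m G φ δ Δ C η) (u v : Fin n) :
    devInter m G u v m ([] : State n K) = 0 := by
  have hm := h.m_pos.ne'
  unfold devInter density
  split_ifs
  · rfl
  · simp [freeAt_nil, div_self hm]

theorem devNbr_nil (h : Admissible K m G φ δ Δ C η) (u : Fin n) (c : Fin K) :
    devNbr m G u c m ([] : State n K) = 0 := by
  have hm := h.m_pos.ne'
  have h1 : nbrFree (remaining G ([] : State n K)) (freeAt ([] : State n K)) u c =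
      (G.neighborSet u).toFinset := by
    ext w
    simp [mem_nbrFree, remaining, freeAt_nil]
  unfold devNbr density
  rw [h1, div_self hm, Set.ncard_eq_toFinset_card']
  simp

theorem potential_nil (h : Admissible K m G φ δ Δ C η) :
    potential m G Δ C η m ([] : State n K) =
      2 * (n * n + n * K) * Real.exp (-(η * (η * Δ))) := by
  have hm := h.m_pos.ne'
  unfold potential
  simp only [h.devInter_nil, h.devNbr_nil, pot_zero, envelope, div_self hm]
  simp
  ring

/-- The failure probability of the whole game. -/
theorem failProb_nil_le (h : Admissible K m G φ δ Δ C η)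
    (hR : (remaining G ([] : State n K)).card ≤ m) :
    failProb G m ([] : State n K) ≤ 2 * (n * n + n * K) * Real.exp (-(η * (η * Δ))) := by
  rw [← h.potential_nil]
  exact h.failProb_le_potential h.stop_le le_rfl hR (by simp [AllColored])

end Admissible

end Bound

section Expectation

variable {n K : ℕ}

/-- The expectation of `h` after `i` steps of the greedy algorithm against the sequence `x`. -/
noncomputable def expect (x : ℕ → Option (Sym2 (Fin n))) : ℕ → (State n K → ℝ) → ℝ
  | 0, h => h []
  | i + 1, h => expect x i fun s => stepExp s h (x i)

theorem stepExp_congr {s : State n K} {h h' : State n K → ℝ} (o : Option (Sym2 (Fin n)))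
    (hh : ∀ c, h (s ++ [(o, c)]) = h' (s ++ [(o, c)])) : stepExp s h o = stepExp s h' o := by
  cases o <;> simp only [stepExp, hh]

theorem stepExp_nonneg {s : State n K} {h : State n K → ℝ} (o : Option (Sym2 (Fin n)))
    (hh : ∀ s, 0 ≤ h s) : 0 ≤ stepExp s h o := by
  cases o with
  | none => exact hh _
  | some e =>
    simp only [stepExp]
    split_ifs
    · exact div_nonneg (Finset.sum_nonneg fun _ _ => hh _) (Nat.cast_nonneg _)
    · exact hh _

theorem stepExp_add (s : State n K) (h h' : State n K → ℝ) (o : Option (Sym2 (Fin n))) :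
    stepExp s (fun s => h s + h' s) o = stepExp s h o + stepExp s h' o := by
  cases o with
  | none => rfl
  | some e =>
    simp only [stepExp]
    split_ifs
    · rw [Finset.sum_add_distrib, add_div]
    · rfl

theorem stepExp_const_mul (s : State n K) (a : ℝ) (h : State n K → ℝ)
    (o : Option (Sym2 (Fin n))) : stepExp s (fun s => a * h s) o = a * stepExp s h o := by
  cases o with
  | none => rfl
  | some e =>
    simp only [stepExp]
    split_ifs
    · rw [← Finset.mul_sum, mul_div_assoc]
    · rfl

theorem expect_add (x : ℕ → Option (Sym2 (Fin n))) (i : ℕ) (h h' : State n K → ℝ) :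
    expect x i (fun s => h s + h' s) = expect x i h + expect x i h' := by
  induction i generalizing h h' with
  | zero => rfl
  | succ i ih => simp only [expect, stepExp_add, ih]

theorem expect_const_mul (x : ℕ → Option (Sym2 (Fin n))) (i : ℕ) (a : ℝ) (h : State n K → ℝ) :
    expect x i (fun s => a * h s) = a * expect x i h := by
  induction i generalizing h with
  | zero => rfl
  | succ i ih => simp only [expect, stepExp_const_mul, ih]

theorem expect_sum {ι : Type*} (S : Finset ι) (x : ℕ → Option (Sym2 (Fin n))) (i : ℕ)
    (h : ι → State n K → ℝ) :
    expect x i (fun s => ∑ j ∈ S, h j s) = ∑ j ∈ S, expect x i (h j) := by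
  induction S using Finset.induction_on with
  | empty => simpa using expect_const_mul x i 0 fun _ => (0 : ℝ)
  | insert a S ha ih => simp only [Finset.sum_insert ha, expect_add, ih]

theorem expect_congr {x : ℕ → Option (Sym2 (Fin n))} {i : ℕ} {h h' : State n K → ℝ}
    (hh : ∀ s : State n K, s.map Prod.fst = (List.range i).map x → h s = h' s) :
    expect x i h = expect x i h' := by
  induction i generalizing h h' with
  | zero => exact hh [] rfl
  | succ i ih =>
    refine ih fun s hs => stepExp_congr _ fun c => hh _ ?_
    rw [List.range_succ, List.map_append, List.map_append, hs]
    rfl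

theorem expect_congr_left {x y : ℕ → Option (Sym2 (Fin n))} {i : ℕ} (h : State n K → ℝ)
    (hxy : ∀ k < i, x k = y k) : expect x i h = expect y i h := by
  induction i generalizing h with
  | zero => rfl
  | succ i ih =>
    simp only [expect, hxy i (Nat.lt_succ_self i)]
    exact ih _ fun k hk => hxy k (hk.trans (Nat.lt_succ_self i))

theorem tsum_bind_mul {α β : Type*} (p : PMF α) (q : α → PMF β) (g : β → ENNReal) :
    ∑' b, p.bind q b * g b = ∑' a, p a * ∑' b, q a b * g b := by
  simp only [PMF.bind_apply, ← ENNReal.tsum_mul_right, ← ENNReal.tsum_mul_left]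
  rw [ENNReal.tsum_comm]
  simp only [mul_assoc]

theorem tsum_pure_mul {α : Type*} (a : α) (g : α → ENNReal) :
    ∑' b, PMF.pure a b * g b = g a := by
  rw [tsum_eq_single a fun b hb => by rw [PMF.pure_apply_of_ne _ _ hb, zero_mul],
    PMF.pure_apply_self, one_mul]

theorem tsum_map_mul {α β : Type*} (p : PMF α) (k : α → β) (g : β → ENNReal) :
    ∑' b, p.map k b * g b = ∑' a, p a * g (k a) := by
  rw [PMF.map, tsum_bind_mul]
  simp only [Function.comp, tsum_pure_mul]

theorem tsum_greedyStep_mul (s : State n K) (o : Option (Sym2 (Fin n))) {h : State n K → ℝ}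
    (hh : ∀ s, 0 ≤ h s) :
    ∑' c, greedyStep n K s o c * ENNReal.ofReal (h (s ++ [(o, c)])) =
      ENNReal.ofReal (stepExp s h o) := by
  cases o with
  | none => exact tsum_pure_mul _ _
  | some e =>
    simp only [greedyStep, stepExp]
    split_ifs with hne
    · rw [tsum_map_mul, tsum_fintype, ENNReal.ofReal_div_of_pos (by exact_mod_cast hne.card_pos),
        ENNReal.ofReal_sum_of_nonneg fun _ _ => hh _, ENNReal.ofReal_natCast, div_eq_mul_inv,
        Finset.sum_mul]
      simp only [PMF.uniformOfFinset_apply, ite_mul, zero_mul]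
      rw [← Finset.sum_filter, Finset.filter_univ_mem]
      exact Finset.sum_congr rfl fun _ _ => mul_comm _ _
    · exact tsum_pure_mul _ _

theorem length_of_mem_support_run (B : State n K → Option (Sym2 (Fin n))) (i : ℕ)
    {s : State n K} (hs : s ∈ (run n K B i).support) : s.length = i := by
  induction i generalizing s with
  | zero => simpa [run] using hs
  | succ i ih =>
    simp only [run, PMF.mem_support_bind_iff, PMF.support_map, Set.mem_image] at hs
    obtain ⟨t, ht, c, -, rfl⟩ := hs
    simp [ih ht]

theorem tsum_run_mul {B : State n K → Option (Sym2 (Fin n))} {x : ℕ → Option (Sym2 (Fin n))}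
    (hB : ∀ s, B s = x s.length) (i : ℕ) {h : State n K → ℝ} (hh : ∀ s, 0 ≤ h s) :
    ∑' s, run n K B i s * ENNReal.ofReal (h s) = ENNReal.ofReal (expect x i h) := by
  induction i generalizing h with
  | zero => exact tsum_pure_mul _ _
  | succ i ih =>
    simp only [run, expect]
    rw [tsum_bind_mul, ← ih fun s => stepExp_nonneg _ hh]
    refine tsum_congr fun s => ?_
    by_cases hs : s ∈ (run n K B i).support
    · rw [tsum_map_mul, tsum_greedyStep_mul _ _ hh, hB, length_of_mem_support_run B i hs]
    · rw [PMF.mem_support_iff, not_not] at hs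
      rw [hs, zero_mul, zero_mul]

theorem toOuterMeasure_colorsAll (G : SimpleGraph (Fin n))
    {B : State n K → Option (Sym2 (Fin n))} {x : ℕ → Option (Sym2 (Fin n))}
    (hB : ∀ s, B s = x s.length) (i : ℕ) :
    (run n K B i).toOuterMeasure {s | ColorsAll n K G s} =
      1 - ENNReal.ofReal (expect x i (failProb (K := K) G 0)) := by
  refine ENNReal.eq_sub_of_add_eq ENNReal.ofReal_ne_top ?_
  rw [← tsum_run_mul hB i (fun s => by unfold failProb; split_ifs <;> norm_num),
    PMF.toOuterMeasure_apply, ← ENNReal.tsum_add, ← (run n K B i).tsum_coe]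
  refine tsum_congr fun s => ?_
  by_cases hs : ColorsAll n K G s
  · simp [failProb, hs, Set.indicator]
  · simp [failProb, hs, Set.indicator]

end Expectation

section Average

variable {n m : ℕ} {G : SimpleGraph (Fin n)}

/-- The sequence of presented edges of the injection `σ`. -/
noncomputable def presented (σ : G.edgeSet ↪ Fin m) (i : ℕ) : Option (Sym2 (Fin n)) :=
  if h : ∃ e : G.edgeSet, ((σ e : Fin m) : ℕ) = i then some h.choose.1 else none

theorem presented_eq_some_iff {σ : G.edgeSet ↪ Fin m} {i : ℕ} {e : Sym2 (Fin n)} :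
    presented σ i = some e ↔ ∃ he : e ∈ G.edgeSet, ((σ ⟨e, he⟩ : Fin m) : ℕ) = i := by
  unfold presented
  constructor
  · intro h
    split_ifs at h with hex
    rw [← Option.some.inj h]
    exact ⟨hex.choose.2, hex.choose_spec⟩
  · rintro ⟨he, hi⟩
    have hex : ∃ e : G.edgeSet, ((σ e : Fin m) : ℕ) = i := ⟨⟨e, he⟩, hi⟩
    rw [dif_pos hex]
    have := σ.injective (Fin.ext (hex.choose_spec.trans hi.symm))
    rw [this]

theorem stepExp_presented {K : ℕ} (σ : G.edgeSet ↪ Fin m) (i : ℕ) (s : State n K)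
    (h : State n K → ℝ) :
    stepExp s h (presented σ i) = h (s ++ [(none, none)]) + ∑ e : G.edgeSet,
      (if ((σ e : Fin m) : ℕ) = i then 1 else 0) *
        (stepExp s h (some e.1) - h (s ++ [(none, none)])) := by
  rcases hx : presented σ i with _ | e
  · rw [Finset.sum_eq_zero]
    · simp [stepExp]
    · intro e _
      rw [if_neg, zero_mul]
      intro he
      rw [presented_eq_some_iff.2 ⟨e.2, he⟩] at hx
      simp at hx
  · obtain ⟨he, hi⟩ := presented_eq_some_iff.1 hx
    rw [Finset.sum_eq_single ⟨e, he⟩]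
    · rw [if_pos hi]; ring
    · intro e' _ hne
      rw [if_neg, zero_mul]
      exact fun h' => hne (σ.injective (Fin.ext (h'.trans hi.symm)))
    · simp

theorem mem_remaining_iff {K : ℕ} {σ : G.edgeSet ↪ Fin m} {i : ℕ} {s : State n K}
    (hs : s.map Prod.fst = (List.range i).map (presented σ)) (e : G.edgeSet) :
    e.1 ∈ remaining G s ↔ i ≤ (σ e : Fin m) := by
  have h1 : (∀ p ∈ s, p.1 ≠ some e.1) ↔ some e.1 ∉ s.map Prod.fst := by
    rw [List.mem_map]
    exact ⟨fun h ⟨p, hp, hpe⟩ => h p hp hpe, fun h p hp hpe => h ⟨p, hp, hpe⟩⟩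
  have h2 : some e.1 ∈ (List.range i).map (presented σ) ↔ ((σ e : Fin m) : ℕ) < i := by
    simp only [List.mem_map, List.mem_range, presented_eq_some_iff]
    exact ⟨fun ⟨k, hk, _, h⟩ => h ▸ hk, fun h => ⟨_, h, e.2, rfl⟩⟩
  simp only [remaining, Finset.mem_filter, Finset.mem_univ, true_and]
  rw [h1, hs, h2, not_lt, and_iff_right e.2]

/-- Slots from `i` on are exchangeable before time `i`. -/
theorem sum_expect_presented_eq {K : ℕ} (e : G.edgeSet) (i j : Fin m) (hij : i ≤ j)
    (h : State n K → ℝ) :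
    ∑ σ : G.edgeSet ↪ Fin m, (if σ e = j then 1 else 0) * expect (presented σ) i h =
      ∑ σ : G.edgeSet ↪ Fin m, (if σ e = i then 1 else 0) * expect (presented σ) i h := by
  refine Fintype.sum_equiv
    (Equiv.embeddingCongr (Equiv.refl _) (Equiv.swap i j)) _ _ fun σ => ?_
  have h1 : ∀ e, (Equiv.embeddingCongr (Equiv.refl _) (Equiv.swap i j)) σ e =
      Equiv.swap i j (σ e) := fun e => rfl
  rw [h1]
  congr 1
  · congr 1
    rw [Equiv.swap_apply_eq_iff, Equiv.swap_apply_left]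
  · refine expect_congr_left h fun k hk => Option.ext fun e' => ?_
    rw [presented_eq_some_iff, presented_eq_some_iff]
    refine exists_congr fun he => ?_
    rw [h1]
    have hkm : k < m := hk.trans i.2
    have h2 : Equiv.swap i j ⟨k, hkm⟩ = ⟨k, hkm⟩ := by
      refine Equiv.swap_apply_of_ne_of_ne (fun h => ?_) fun h => ?_
      · rw [← h] at hk; simp at hk
      · rw [← h] at hij
        exact absurd hk (not_lt.2 hij)
    have h3 : ∀ a : Fin m, (a : ℕ) = k ↔ a = ⟨k, hkm⟩ := fun a => by rw [Fin.ext_iff]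
    rw [h3, h3, Equiv.swap_apply_eq_iff, h2]

theorem sum_expect_succ {K : ℕ} (G : SimpleGraph (Fin n)) {i r : ℕ} (hm : i + (r + 1) = m) :
    ∑ σ : G.edgeSet ↪ Fin m, expect (presented σ) (i + 1) (failProb (K := K) G r) =
      ∑ σ : G.edgeSet ↪ Fin m, expect (presented σ) i (failProb (K := K) G (r + 1)) := by
  set D : G.edgeSet → State n K → ℝ := fun e s =>
    stepExp s (failProb G r) (some e.1) - failProb G r (s ++ [(none, none)])
  have hi : i < m := by omega
  have h1 : ∀ σ : G.edgeSet ↪ Fin m, expect (presented σ) (i + 1) (failProb (K := K) G r) =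
      expect (presented σ) i (fun s => failProb (K := K) G r (s ++ [(none, none)])) +
        ∑ e, (if σ e = ⟨i, hi⟩ then 1 else 0) * expect (presented σ) i (D e) := by
    intro σ
    simp only [expect, stepExp_presented]
    rw [expect_add, expect_sum]
    simp only [expect_const_mul, Fin.ext_iff]
    rfl
  have h2 : ∀ σ : G.edgeSet ↪ Fin m, expect (presented σ) i (failProb (K := K) G (r + 1)) =
      expect (presented σ) i (fun s => failProb (K := K) G r (s ++ [(none, none)])) +
        ∑ e, 1 / (r + 1 : ℝ) * ((if ⟨i, hi⟩ ≤ σ e then 1 else 0) *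
          expect (presented σ) i (D e)) := by
    intro σ
    simp only [← expect_const_mul]
    rw [← expect_sum, ← expect_add]
    refine expect_congr fun s hs => ?_
    simp only [failProb]
    congr 1
    rw [← Finset.mul_sum, one_div, inv_mul_eq_div]
    congr 1
    have h3 : ∑ e : G.edgeSet, (if (⟨i, hi⟩ : Fin m) ≤ σ e then (1 : ℝ) else 0) * D e s =
        ∑ e : G.edgeSet, if e.1 ∈ remaining G s then D e s else 0 := by
      refine Finset.sum_congr rfl fun e _ => ?_
      rw [ite_mul, one_mul, zero_mul]
      exact if_congr (mem_remaining_iff hs e).symm rfl rfl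
    rw [h3]
    have h4 : remaining G s ⊆ Finset.univ.filter (· ∈ G.edgeSet) := fun e he => by
      simp only [remaining, Finset.mem_filter, Finset.mem_univ, true_and] at he ⊢
      exact he.1
    rw [← Finset.inter_eq_right.2 h4, ← Finset.sum_ite_mem,
      Finset.sum_subtype _ (p := (· ∈ G.edgeSet)) (fun e => by simp)]
    simp only [Finset.inter_eq_right.2 h4]
    rfl
  have h3 : ∀ e, ∑ σ : G.edgeSet ↪ Fin m, (if σ e = ⟨i, hi⟩ then 1 else 0) *
      expect (presented σ) i (D e) = ∑ σ : G.edgeSet ↪ Fin m, 1 / (r + 1 : ℝ) *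
        ((if ⟨i, hi⟩ ≤ σ e then 1 else 0) * expect (presented σ) i (D e)) := by
    intro e
    have hcard : ((Finset.Ici (⟨i, hi⟩ : Fin m)).card : ℝ) = r + 1 := by
      rw [Fin.card_Ici]
      have : m - i = r + 1 := by omega
      simp [this]
    have h4 : ∀ σ : G.edgeSet ↪ Fin m, (if ⟨i, hi⟩ ≤ σ e then (1 : ℝ) else 0) =
        ∑ j ∈ Finset.Ici (⟨i, hi⟩ : Fin m), if σ e = j then 1 else 0 := by
      intro σ
      rw [Finset.sum_ite_eq]
      simp
    have h5 : ∀ j ∈ Finset.Ici (⟨i, hi⟩ : Fin m), ∑ σ : G.edgeSet ↪ Fin m,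
        (if σ e = j then 1 else 0) * expect (presented σ) i (D e) = ∑ σ : G.edgeSet ↪ Fin m,
        (if σ e = ⟨i, hi⟩ then 1 else 0) * expect (presented σ) i (D e) := fun j hj =>
      sum_expect_presented_eq e ⟨i, hi⟩ j (Finset.mem_Ici.1 hj) _
    simp only [h4, Finset.sum_mul]
    rw [← Finset.mul_sum, Finset.sum_comm, Finset.sum_congr rfl h5, Finset.sum_const,
      nsmul_eq_mul, hcard, ← mul_assoc, one_div_mul_cancel (by positivity), one_mul]
  simp only [h1, h2, Finset.sum_add_distrib]
  congr 1
  rw [Finset.sum_comm, Finset.sum_congr rfl fun e _ => h3 e, Finset.sum_comm]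

/-- The average failure probability over all injections. -/
theorem sum_expect_eq {K : ℕ} (G : SimpleGraph (Fin n)) (m : ℕ) :
    ∑ σ : G.edgeSet ↪ Fin m, expect (presented σ) m (failProb (K := K) G 0) =
      (Fintype.card (G.edgeSet ↪ Fin m) : ℝ) * failProb G m ([] : State n K) := by
  have h : ∀ i r, i + r = m → ∑ σ : G.edgeSet ↪ Fin m,
      expect (presented σ) i (failProb (K := K) G r) =
      (Fintype.card (G.edgeSet ↪ Fin m) : ℝ) * failProb G m ([] : State n K) := by
    intro i
    induction i with
    | zero =>
      intro r hr
      rw [zero_add] at hr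
      subst hr
      simp [expect]
    | succ i ih => exact fun r hr => (sum_expect_succ G (by omega)).trans (ih _ (by omega))
  exact h m 0 (by omega)

end Average

section Final

variable {n K m : ℕ} {G : SimpleGraph (Fin n)}

theorem expect_nonneg (x : ℕ → Option (Sym2 (Fin n))) (i : ℕ) {h : State n K → ℝ}
    (hh : ∀ s, 0 ≤ h s) : 0 ≤ expect x i h := by
  induction i generalizing h with
  | zero => exact hh _
  | succ i ih => exact ih fun s => stepExp_nonneg _ hh

theorem card_remaining_nil_le (σ : G.edgeSet ↪ Fin m) :
    (remaining G ([] : State n K)).card ≤ m := by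
  have h1 : (remaining G ([] : State n K)).card = Fintype.card G.edgeSet := by
    rw [Fintype.card_subtype]
    simp [remaining]
  rw [h1]
  simpa using Fintype.card_le_of_embedding σ

/-- Markov's inequality over the injections. -/
theorem card_bad_le {t : ℝ} (ht : 0 < t)
    (hfail : (remaining G ([] : State n K)).card ≤ m →
      failProb G m ([] : State n K) ≤ t * t) :
    ((Finset.univ.filter fun σ : G.edgeSet ↪ Fin m =>
      ¬ (1 - ENNReal.ofReal t ≤ (run n K (obl n K m G σ) m).toOuterMeasure
        {s | ColorsAll n K G s})).card : ℝ) ≤ t * (Fintype.card (G.edgeSet ↪ Fin m) : ℝ) := by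
  rcases isEmpty_or_nonempty (G.edgeSet ↪ Fin m) with hemp | ⟨⟨σ₀⟩⟩
  · simp
  have hf0 : ∀ s : State n K, 0 ≤ failProb G 0 s := fun s => by
    unfold failProb; split_ifs <;> norm_num
  set bad := Finset.univ.filter fun σ : G.edgeSet ↪ Fin m =>
      ¬ (1 - ENNReal.ofReal t ≤ (run n K (obl n K m G σ) m).toOuterMeasure
        {s | ColorsAll n K G s}) with hbad
  have h1 : ∀ σ ∈ bad, t ≤ expect (presented σ) m (failProb (K := K) G 0) := by
    intro σ hσ
    rw [hbad, Finset.mem_filter] at hσ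
    by_contra! hlt
    refine hσ.2 ?_
    rw [toOuterMeasure_colorsAll G (B := obl n K m G σ) (x := presented σ) (fun s => rfl)]
    exact tsub_le_tsub_left (ENNReal.ofReal_le_ofReal hlt.le) _
  have h2 : (bad.card : ℝ) * t ≤
      (Fintype.card (G.edgeSet ↪ Fin m) : ℝ) * failProb G m ([] : State n K) := by
    rw [← sum_expect_eq, ← nsmul_eq_mul]
    exact (Finset.card_nsmul_le_sum _ _ _ h1).trans
      (Finset.sum_le_univ_sum_of_nonneg fun σ => expect_nonneg _ _ hf0)
  have h3 := mul_le_mul_of_nonneg_left (hfail (card_remaining_nil_le σ₀))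
    (Nat.cast_nonneg (α := ℝ) (Fintype.card (G.edgeSet ↪ Fin m)))
  refine le_of_mul_le_mul_right ?_ ht
  linarith

/-- The polynomial factor in the initial potential is absorbed by the exponential one. -/
theorem poly_mul_exp_le {a Δ x κ : ℝ} (ha : 0 < a) (hΔ : 256 / a ^ 2 ≤ Δ) (hΔ1 : 1 ≤ Δ)
    (hx : 1 ≤ x) (hxΔ : 8 / a * Real.log x ≤ Δ) (hκ : κ ≤ 3 * Δ) :
    2 * (x * x + x * κ) * Real.exp (-(a * Δ)) ≤ Real.exp (-(a * Δ / 2)) := by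
  have h1 : x * x ≤ Real.exp (a * Δ / 4) := by
    have h2 : Real.log x ≤ a * Δ / 8 := by
      rw [div_mul_eq_mul_div, div_le_iff₀ ha] at hxΔ
      linarith
    have h3 : x ≤ Real.exp (a * Δ / 8) := (Real.log_le_iff_le_exp (by linarith)).1 h2
    calc x * x ≤ Real.exp (a * Δ / 8) * Real.exp (a * Δ / 8) := by gcongr
      _ = _ := by rw [← Real.exp_add]; ring_nf
  have h4 : 8 * Δ ≤ Real.exp (a * Δ / 4) := by
    have h5 := Real.quadratic_le_exp_of_nonneg (x := a * Δ / 4) (by positivity)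
    rw [div_le_iff₀ (by positivity)] at hΔ
    have h6 : 0 ≤ a * Δ / 4 := by positivity
    nlinarith
  have h7 : 2 * (x * x + x * κ) ≤ Real.exp (a * Δ / 2) := by
    have hxx : x ≤ x * x := by nlinarith
    have h8 : x * κ ≤ x * x * (3 * Δ) :=
      (mul_le_mul_of_nonneg_left hκ (by linarith)).trans
        (mul_le_mul_of_nonneg_right hxx (by linarith))
    have h9 : x * x ≤ x * x * Δ := le_mul_of_one_le_right (by positivity) hΔ1
    calc 2 * (x * x + x * κ) ≤ x * x * (8 * Δ) := by linarith
      _ ≤ Real.exp (a * Δ / 4) * Real.exp (a * Δ / 4) := by gcongr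
      _ = _ := by rw [← Real.exp_add]; ring_nf
  calc _ ≤ Real.exp (a * Δ / 2) * Real.exp (-(a * Δ)) := by gcongr
    _ = _ := by rw [← Real.exp_add]; ring_nf

/-- **Random-order case.** For every `ε ∈ (0,1)` there are constants
`N, γ₁, γ₂ > 0` such that for all sufficiently large `n` and all
`Δ > N·log n`, for every simple graph `G` on `n` vertices with maximum degree
at most `Δ`: for all but at most a `2^{−γ₁Δ}` fraction of the injections
`σ : E(G) → {1,…,⌊nΔ/2⌋}`, the randomized greedy algorithm, playing the game
`Φ(n,Δ,ε)` (with `⌈(1+ε)Δ⌉` colors) against the oblivious strategy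
`obl(G,σ)`, colors every edge of `G` with probability at least `1 − 2^{−γ₂Δ}`. -/
theorem random_order (ε : ℝ) (hε0 : 0 < ε) (hε1 : ε < 1) :
    ∃ N γ₁ γ₂ : ℝ, 0 < N ∧ 0 < γ₁ ∧ 0 < γ₂ ∧ ∃ n₀ : ℕ, ∀ n : ℕ, n₀ ≤ n →
      ∀ Δ : ℕ, N * Real.log n < (Δ : ℝ) →
      ∀ G : SimpleGraph (Fin n), (∀ v, (G.neighborSet v).ncard ≤ Δ) →
        ((Finset.univ.filter fun σ : G.edgeSet ↪ Fin (n * Δ / 2) =>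
            ¬ (1 - ENNReal.ofReal ((2 : ℝ) ^ (-(γ₂ * (Δ : ℝ)))) ≤
                (run n ⌈(1 + ε) * (Δ : ℝ)⌉₊
                    (obl n ⌈(1 + ε) * (Δ : ℝ)⌉₊ (n * Δ / 2) G σ)
                    (n * Δ / 2)).toOuterMeasure
                  {s | ColorsAll n ⌈(1 + ε) * (Δ : ℝ)⌉₊ G s})).card : ℝ) ≤
          (2 : ℝ) ^ (-(γ₁ * (Δ : ℝ))) *
            (Fintype.card (G.edgeSet ↪ Fin (n * Δ / 2)) : ℝ) := by
  obtain ⟨φ, hφ⟩ : ∃ φ, φ = ε / 2 := ⟨_, rfl⟩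
  have hφ0 : 0 < φ := by linarith
  obtain ⟨δ, hδ⟩ : ∃ δ, δ = φ ^ 4 / 32 := ⟨_, rfl⟩
  have hδ0 : 0 < δ := by rw [hδ]; positivity
  obtain ⟨C, hC⟩ : ∃ C, C = 24 / (φ ^ 5 * δ) := ⟨_, rfl⟩
  obtain ⟨η, hη⟩ : ∃ η, η = φ ^ 4 / 16 * Real.exp (-C) := ⟨_, rfl⟩
  have hη0 : 0 < η := by rw [hη]; positivity
  have ha : 0 < η * η := by positivity
  set M : ℝ := 256 / (η * η) ^ 2 + 1 / η + 1 / δ + 1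
  refine ⟨8 / (η * η), η * η / 4, η * η / 4, by positivity, by positivity, by positivity,
    ⌈Real.exp (M * (η * η) / 8)⌉₊ + 2, fun n hn Δ hΔ G hG => ?_⟩
  have hn2 : 2 ≤ n := by omega
  have hnexp : Real.exp (M * (η * η) / 8) ≤ n :=
    (Nat.le_ceil _).trans (by exact_mod_cast (Nat.le_add_right _ 2).trans hn)
  have hMΔ : M ≤ Δ := by
    have h1 : M * (η * η) / 8 ≤ Real.log n :=
      (Real.le_log_iff_exp_le (by positivity)).2 hnexp
    have h2 := mul_le_mul_of_nonneg_left h1 (show 0 ≤ 8 / (η * η) by positivity)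
    have h3 : 8 / (η * η) * (M * (η * η) / 8) = M := by field_simp
    linarith
  have h256 : 0 < 256 / (η * η) ^ 2 := by positivity
  have hη1 : 0 < 1 / η := by positivity
  have hδ1 : 0 < 1 / δ := by positivity
  have hΔ1 : (1 : ℝ) ≤ Δ := by linarith
  have hΔm : (Δ : ℝ) ≤ (n * Δ / 2 : ℕ) := by
    have : Δ ≤ n * Δ / 2 := by
      rw [Nat.le_div_iff_mul_le (by norm_num), mul_comm]
      exact Nat.mul_le_mul_right _ hn2
    exact_mod_cast this
  have hK := Nat.le_ceil ((1 + ε) * (Δ : ℝ))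
  have hK' : (⌈(1 + ε) * (Δ : ℝ)⌉₊ : ℝ) ≤ 3 * Δ := by
    have := Nat.ceil_lt_add_one (a := (1 + ε) * (Δ : ℝ)) (by positivity)
    nlinarith
  set K := ⌈(1 + ε) * (Δ : ℝ)⌉₊
  have hΔK : (Δ : ℝ) ≤ K := by nlinarith
  have hadm : Admissible K (n * Δ / 2) G φ δ (Δ : ℝ) C η :=
    { φ_pos := hφ0
      φ_le := by linarith
      δ_pos := hδ0
      δ_le := hδ.le
      Δ_pos := by linarith
      Δ_le_m := hΔm
      φ_le_sub := by
        have : (Δ : ℝ) / K ≤ 1 - φ := by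
          rw [div_le_iff₀ (by linarith), hφ]
          have h1 : (1 - ε / 2) * ((1 + ε) * Δ) ≤ (1 - ε / 2) * K :=
            mul_le_mul_of_nonneg_left hK (by linarith)
          have h2 : 0 ≤ ε * (1 - ε) * Δ :=
            mul_nonneg (mul_nonneg hε0.le (by linarith)) (by linarith)
          linarith
        linarith
      deg_le := fun u => by exact_mod_cast hG u
      Δ_le_K := hΔK
      C_eq := hC
      η_pos := hη0
      η_exp_le := by rw [hη, mul_assoc, ← Real.exp_add]; simp
      one_le_η := by
        rw [← div_le_iff₀' hη0]
        linarith
      one_le_δ := by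
        rw [← div_le_iff₀' hδ0]
        linarith }
  refine card_bad_le (by positivity) fun hR => (hadm.failProb_nil_le hR).trans ?_
  have hpoly := poly_mul_exp_le (a := η * η) (Δ := Δ) (x := n) (κ := K) ha (by linarith) hΔ1
    (by exact_mod_cast (by omega : 1 ≤ n)) hΔ.le hK'
  rw [← mul_assoc]
  refine hpoly.trans ?_
  rw [← Real.rpow_add (by norm_num), Real.rpow_def_of_pos (by norm_num)]
  refine Real.exp_le_exp.2 ?_
  have hlog : Real.log 2 ≤ 1 := by linarith [Real.log_two_lt_d9]
  have h0 : 0 ≤ η * η * Δ / 2 := by positivity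
  nlinarith [mul_le_mul_of_nonneg_right hlog h0]

end Final

end RandomGreedyEC
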